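/- Let q > 1 and p ∈ [2q−2, 2q) ∩ (q+1, 2q), and let γ ∈ W^{1,∞}_{i,a}(𝕋, ℝ^n). Then TP^{(p,q)}(γ) ≥ π^{p−q} ∫₀¹ sin(πw)^{2q−p} dw, with equality if and only if the image of γ is a round circle. -/

import Mathlib

open MeasureTheory Real Set intervalIntegral
open scoped ENNReal RealInnerProductSpace

noncomputable section

/-- A closed `W^{1,1}`-curve on the torus `𝕋 = ℝ/ℤ` with values in `ℝⁿ`, encoded as a
`1`-periodic absolutely continuous function `toFun : ℝ → ℝⁿ` together with its
(weak) derivative `deriv'`. -/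
structure ClosedCurve (n : ℕ) where
  toFun : ℝ → EuclideanSpace ℝ (Fin n)
  deriv' : ℝ → EuclideanSpace ℝ (Fin n)
  periodic : Function.Periodic toFun 1
  deriv'_periodic : Function.Periodic deriv' 1
  integrableOn : MeasureTheory.IntegrableOn deriv' (Set.Icc (0:ℝ) 1)
  eq_integral : ∀ t : ℝ, toFun t = toFun 0 + ∫ s in (0:ℝ)..t, deriv' s

namespace ClosedCurve

variable {n : ℕ}

/-- Injectivity as a map on the torus `ℝ/ℤ`. -/
def IsInj (γ : ClosedCurve n) : Prop :=
  ∀ s t : ℝ, γ.toFun s = γ.toFun t → ∃ k : ℤ, s - t = (k : ℝ)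

/-- Regularity: the derivative does not vanish a.e. -/
def IsRegular (γ : ClosedCurve n) : Prop := ∀ᵐ t : ℝ ∂volume, γ.deriv' t ≠ 0

/-- Parametrization by arc length: `|γ'| = 1` a.e. -/
def IsArclength (γ : ClosedCurve n) : Prop := ∀ᵐ t : ℝ ∂volume, ‖γ.deriv' t‖ = 1

/-- The length of a closed curve. -/
def length (γ : ClosedCurve n) : ℝ := ∫ t in (0:ℝ)..1, ‖γ.deriv' t‖

end ClosedCurve

/-- Orthogonal projection onto the orthogonal complement of `span {v}` (for `v ≠ 0`). -/
def projPerp {F : Type*} [NormedAddCommGroup F] [InnerProductSpace ℝ F] (v x : F) : F :=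
  x - (⟪v, x⟫ / ‖v‖ ^ 2) • v

/-- The Gauss map `φ_γ(u,w)`: the unit secant direction. -/
def gaussMap {n : ℕ} (γ : ClosedCurve n) (u w : ℝ) : EuclideanSpace ℝ (Fin n) :=
  ‖γ.toFun (u + w) - γ.toFun u‖⁻¹ • (γ.toFun (u + w) - γ.toFun u)

/-- `|∂_u φ_γ(u,w)|`, expressed via the identity (1.8) of the paper. -/
def gaussDerivU {n : ℕ} (γ : ClosedCurve n) (u w : ℝ) : ℝ :=
  ‖projPerp (gaussMap γ u w) (γ.deriv' (u + w) - γ.deriv' u)‖ /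
    ‖γ.toFun (u + w) - γ.toFun u‖

/-- `|∂_w φ_γ(u,w)|`, expressed via the identity (1.7) of the paper. -/
def gaussDerivW {n : ℕ} (γ : ClosedCurve n) (u w : ℝ) : ℝ :=
  ‖projPerp (gaussMap γ u w) (γ.deriv' (u + w))‖ / ‖γ.toFun (u + w) - γ.toFun u‖

/-- The generalized tangent-point energy `TP^{(p,q)}` (with values in `[0,∞]`). -/
def TP {n : ℕ} (p q : ℝ) (γ : ClosedCurve n) : ℝ≥0∞ :=
  ∫⁻ u in Set.Ioc (0:ℝ) 1, ∫⁻ w in Set.Ioc (0:ℝ) 1,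
    ENNReal.ofReal
      (‖projPerp (γ.deriv' u) (γ.toFun (u + w) - γ.toFun u)‖ ^ q /
        ‖γ.toFun (u + w) - γ.toFun u‖ ^ p * (‖γ.deriv' u‖ * ‖γ.deriv' (u + w)‖))

/-- The minorant `G^{(p,q)}_w`. -/
def Gw {n : ℕ} (p q : ℝ) (γ : ClosedCurve n) (w : ℝ) : ℝ≥0∞ :=
  ∫⁻ u in Set.Ioc (0:ℝ) 1,
    ENNReal.ofReal ((1/2 * gaussDerivU γ u w) ^ q *
      ‖γ.toFun (u + w) - γ.toFun u‖ ^ (2*q - p))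

/-- The minorant `G^{(p,q)}`. -/
def G {n : ℕ} (p q : ℝ) (γ : ClosedCurve n) : ℝ≥0∞ :=
  ∫⁻ w in Set.Ioc (0:ℝ) 1, Gw p q γ w

/-- A round circle in a euclidean space: a sphere intersected with a 2-dimensional plane
through its center. -/
def IsCircle {F : Type*} [NormedAddCommGroup F] [InnerProductSpace ℝ F] (S : Set F) : Prop :=
  ∃ (c : F) (r : ℝ) (V : Submodule ℝ F), 0 < r ∧ Module.finrank ℝ V = 2 ∧
    S = {x | ‖x - c‖ = r ∧ x - c ∈ V}

/-- A great circle of the unit sphere. -/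
def IsGreatCircle {F : Type*} [NormedAddCommGroup F] [InnerProductSpace ℝ F]
    (S : Set F) : Prop :=
  ∃ V : Submodule ℝ F, Module.finrank ℝ V = 2 ∧ S = {x | ‖x‖ = 1 ∧ x ∈ V}

/-- Half of a great circle of the unit sphere: a great-circle arc of angular length `π`. -/
def IsHalfGreatCircle {F : Type*} [NormedAddCommGroup F] [InnerProductSpace ℝ F]
    (S : Set F) : Prop :=
  ∃ a b : F, ‖a‖ = 1 ∧ ‖b‖ = 1 ∧ ⟪a, b⟫ = 0 ∧
    S = (fun t : ℝ => Real.cos t • a + Real.sin t • b) '' Set.Icc 0 π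

/-- A curve is convex if its image is the boundary (within its affine hull) of a convex
planar (2-dimensional) set. -/
def ClosedCurve.IsConvex {n : ℕ} (γ : ClosedCurve n) : Prop :=
  ∃ K : Set (EuclideanSpace ℝ (Fin n)), Convex ℝ K ∧
    Module.finrank ℝ (affineSpan ℝ K).direction = 2 ∧
    Set.range γ.toFun = intrinsicFrontier ℝ K

/-- The `k`-th Fourier coefficient of a real function on the unit interval. -/
def unitFourierCoeff (f : ℝ → ℝ) (k : ℤ) : ℂ :=
  ∫ x in (0:ℝ)..1, Complex.exp (-(2 * π * k * x) * Complex.I) * (f x : ℂ)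

lemma fourier_neg_unit (k : ℤ) (x : ℝ) :
    fourier (-k) (x : AddCircle (1:ℝ)) = Complex.exp (-(2 * π * k * x) * Complex.I) := by
  rw [fourier_coe_apply]
  congr 1
  push_cast
  ring

lemma fourierCoeffOn_eq_unitFourierCoeff (f : ℝ → ℝ) (k : ℤ) :
    fourierCoeffOn (zero_lt_one' ℝ) (fun x => (f x : ℂ)) k = unitFourierCoeff f k := by
  rw [fourierCoeffOn_eq_integral, unitFourierCoeff]
  simp only [sub_zero, div_one, one_smul, smul_eq_mul]
  refine intervalIntegral.integral_congr fun x _ => ?_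
  congr 1
  rw [fourier_coe_apply]
  congr 1
  push_cast
  ring

lemma hasSum_sq_unitFourierCoeff {f : ℝ → ℝ}
    (hf : MemLp f 2 (volume.restrict (Ioc 0 1))) :
    HasSum (fun k => ‖unitFourierCoeff f k‖ ^ 2) (∫ x in (0:ℝ)..1, f x ^ 2) := by
  have h := hasSum_sq_fourierCoeffOn (zero_lt_one' ℝ) (f := fun x => (f x : ℂ)) hf.ofReal
  simpa [fourierCoeffOn_eq_unitFourierCoeff] using h

lemma unitFourierCoeff_comp_add {f : ℝ → ℝ} (hf : Function.Periodic f 1) (w : ℝ) (k : ℤ) :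
    unitFourierCoeff (fun x => f (x + w)) k =
      Complex.exp ((2 * π * k * w) * Complex.I) * unitFourierCoeff f k := by
  set h : ℝ → ℂ := fun x => Complex.exp (-(2 * π * k * x) * Complex.I) * (f x : ℂ) with hh
  have hper : Function.Periodic h 1 := by
    intro x
    simp only [hh, hf x]
    congr 1
    rw [show -(2 * π * k * ((x + 1 : ℝ) : ℂ)) * Complex.I =
      -(2 * π * k * x) * Complex.I - k * (2 * π * Complex.I) by push_cast; ring]
    rw [Complex.exp_sub, Complex.exp_int_mul_two_pi_mul_I, div_one]
  have h1 : ∫ x in (0:ℝ)..1, h (x + w) = ∫ x in (0:ℝ)..1, h x := by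
    rw [intervalIntegral.integral_comp_add_right, zero_add, add_comm]
    simpa using hper.intervalIntegral_add_eq w 0
  rw [unitFourierCoeff, unitFourierCoeff, ← h1, ← intervalIntegral.integral_const_mul]
  refine intervalIntegral.integral_congr fun x _ => ?_
  simp only [hh]
  rw [← mul_assoc, ← Complex.exp_add]
  congr 2
  push_cast
  ring

lemma integral_eq_sub_of_ae_hasDerivAt {g g' : ℝ → ℂ} {a b : ℝ} {K : NNReal}
    (hg : LipschitzOnWith K g (uIcc a b)) (hd : ∀ᵐ x, HasDerivAt g (g' x) x)
    (hi : IntervalIntegrable g' volume a b) : ∫ x in a..b, g' x = g b - g a := by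
  have hre : LipschitzOnWith (‖Complex.reCLM‖₊ * K) (fun x => (g x).re) (uIcc a b) :=
    Complex.reCLM.lipschitz.comp_lipschitzOnWith hg
  have him : LipschitzOnWith (‖Complex.imCLM‖₊ * K) (fun x => (g x).im) (uIcc a b) :=
    Complex.imCLM.lipschitz.comp_lipschitzOnWith hg
  apply Complex.ext
  · have := hre.absolutelyContinuousOnInterval.integral_deriv_eq_sub
    rw [Complex.sub_re, ← this, ← Complex.reCLM_apply, ← Complex.reCLM.intervalIntegral_comp_comm hi]
    refine intervalIntegral.integral_congr_ae ?_
    filter_upwards [hd] with x hx _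
    exact (Complex.reCLM.hasFDerivAt.comp_hasDerivAt x hx).deriv.symm
  · have := him.absolutelyContinuousOnInterval.integral_deriv_eq_sub
    rw [Complex.sub_im, ← this, ← Complex.imCLM_apply, ← Complex.imCLM.intervalIntegral_comp_comm hi]
    refine intervalIntegral.integral_congr_ae ?_
    filter_upwards [hd] with x hx _
    exact (Complex.imCLM.hasFDerivAt.comp_hasDerivAt x hx).deriv.symm

lemma norm_le_of_hasDerivAt_of_lipschitzWith {F : Type*} [NormedAddCommGroup F] [NormedSpace ℝ F]
    {f : ℝ → F} {K : NNReal} {x : ℝ} {v : F} (hf : LipschitzWith K f) (hv : HasDerivAt f v x) :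
    ‖v‖ ≤ K := by
  rw [← hv.deriv]
  exact norm_deriv_le_of_lipschitz hf

lemma unitFourierCoeff_deriv {f f' : ℝ → ℝ} {K : NNReal} (hf : LipschitzWith K f)
    (hper : Function.Periodic f 1) (hd : ∀ᵐ x, HasDerivAt f (f' x) x) (hm : Measurable f')
    (k : ℤ) :
    unitFourierCoeff f' k = 2 * π * k * Complex.I * unitFourierCoeff f k := by
  set e : ℝ → ℂ := fun x => Complex.exp (-(2 * π * k * x) * Complex.I) with he
  have hed : ∀ x, HasDerivAt e (-(2 * π * k * Complex.I) * e x) x := by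
    intro x
    have h1 : HasDerivAt (fun x : ℝ => -(2 * π * k * (x:ℂ)) * Complex.I)
        (-(2 * π * k * 1) * Complex.I) x :=
      (((Complex.ofRealCLM.hasDerivAt (x := x)).const_mul (2 * π * k : ℂ)).neg).mul_const Complex.I
    convert h1.cexp using 1
    simp only [he]
    ring
  have hec : Continuous e := by fun_prop
  have hen : ∀ x, ‖e x‖ = 1 := by
    intro x
    simp only [he]
    rw [show -(2 * π * k * (x:ℂ)) * Complex.I = ((-(2 * π * k * x) : ℝ) : ℂ) * Complex.I by
      push_cast; ring]
    exact Complex.norm_exp_ofReal_mul_I _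
  have heL : LipschitzWith ‖(2 * π * k * Complex.I : ℂ)‖₊ e := by
    refine lipschitzWith_of_nnnorm_deriv_le (fun x => (hed x).differentiableAt) fun x => ?_
    rw [(hed x).deriv, nnnorm_mul, nnnorm_neg]
    have : ‖e x‖₊ = 1 := by ext; simpa using hen x
    rw [this, mul_one]
  obtain ⟨C, hC⟩ : ∃ C : ℝ, ∀ x ∈ Icc (0:ℝ) 1, ‖f x‖ ≤ C :=
    isCompact_Icc.exists_bound_of_continuousOn hf.continuous.continuousOn
  have hgL : ∃ M : NNReal, LipschitzOnWith M (fun x => e x * (f x : ℂ)) (uIcc 0 1) := by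
    refine ⟨K + ‖(2 * π * k * Complex.I : ℂ)‖₊ * C.toNNReal,
      LipschitzOnWith.of_dist_le_mul fun x hx y hy => ?_⟩
    rw [uIcc_of_le zero_le_one] at hx hy
    rw [dist_eq_norm, show e x * (f x : ℂ) - e y * (f y : ℂ) =
      e x * ((f x - f y : ℝ) : ℂ) + (e x - e y) * (f y : ℂ) by push_cast; ring]
    refine (norm_add_le _ _).trans ?_
    rw [norm_mul, norm_mul, hen, one_mul, Complex.norm_real, Complex.norm_real]
    have h1 := hf.dist_le_mul x y
    have h2 := heL.dist_le_mul x y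
    rw [dist_eq_norm] at h1 h2
    have h3 : ‖f y‖ ≤ C.toNNReal := (hC y hy).trans (Real.le_coe_toNNReal C)
    have h4 := mul_le_mul h2 h3 (norm_nonneg _) (by positivity)
    rw [NNReal.coe_add, NNReal.coe_mul]
    linarith
  obtain ⟨M, hM⟩ := hgL
  have hf'b : ∀ᵐ x, ‖f' x‖ ≤ K := by
    filter_upwards [hd] with x hx using norm_le_of_hasDerivAt_of_lipschitzWith hf hx
  have hi1 : IntervalIntegrable (fun x => e x * (f' x : ℂ)) volume 0 1 := by
    rw [intervalIntegrable_iff]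
    refine Measure.integrableOn_of_bounded (M := K) (by simp) ?_ ?_
    · exact (hec.measurable.mul (Complex.measurable_ofReal.comp hm)).aestronglyMeasurable
    · refine ae_restrict_of_ae ?_
      filter_upwards [hf'b] with x hx
      rw [norm_mul, hen, one_mul, Complex.norm_real]
      exact hx
  have hi2 : IntervalIntegrable (fun x => (-(2 * π * k * Complex.I) : ℂ) * (e x * (f x : ℂ)))
      volume 0 1 := by
    refine Continuous.intervalIntegrable ?_ _ _
    have := hf.continuous
    fun_prop
  have key := integral_eq_sub_of_ae_hasDerivAt (g := fun x => e x * (f x : ℂ))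
    (g' := fun x => (-(2 * π * k * Complex.I) : ℂ) * (e x * (f x : ℂ)) + e x * (f' x : ℂ)) hM
    (by
      filter_upwards [hd] with x hx
      exact ((hed x).fun_mul hx.ofReal_comp).congr_deriv (by ring)) (hi2.add hi1)
  rw [intervalIntegral.integral_add hi2 hi1, intervalIntegral.integral_const_mul] at key
  have hb : e 1 * (f 1 : ℂ) - e 0 * (f 0 : ℂ) = 0 := by
    have h1 : f 1 = f 0 := by simpa using hper 0
    have h2 : e 1 = 1 := by
      simp only [he]
      rw [show -(2 * π * k * ((1:ℝ):ℂ)) * Complex.I = ((-k : ℤ) : ℂ) * (2 * π * Complex.I) by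
        push_cast; ring]
      exact Complex.exp_int_mul_two_pi_mul_I _
    have h3 : e 0 = 1 := by simp [he]
    rw [h1, h2, h3, sub_self]
  rw [hb] at key
  simp only [unitFourierCoeff]
  linear_combination key

lemma abs_sin_nat_mul_le (k : ℕ) (x : ℝ) : |Real.sin (k * x)| ≤ k * |Real.sin x| := by
  induction k with
  | zero => simp
  | succ k ih =>
    rw [show ((k + 1 : ℕ) : ℝ) * x = k * x + x by push_cast; ring, Real.sin_add]
    refine (abs_add_le _ _).trans ?_
    rw [abs_mul, abs_mul]
    have h1 := mul_le_mul ih (Real.abs_cos_le_one x) (abs_nonneg _) (by positivity)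
    have h2 := mul_le_mul_of_nonneg_right (Real.abs_cos_le_one (k * x)) (abs_nonneg (Real.sin x))
    push_cast
    linarith

lemma abs_sin_nat_mul_lt {k : ℕ} (hk : 2 ≤ k) {x : ℝ} (hx : Real.sin x ≠ 0) :
    |Real.sin (k * x)| < k * |Real.sin x| := by
  obtain ⟨j, rfl⟩ : ∃ j, k = j + 1 := ⟨k - 1, by omega⟩
  have hj : (0:ℝ) < j := by exact_mod_cast (by omega : 0 < j)
  rw [show ((j + 1 : ℕ) : ℝ) * x = j * x + x by push_cast; ring, Real.sin_add]
  refine (abs_add_le _ _).trans_lt ?_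
  rw [abs_mul, abs_mul]
  have hs : 0 < |Real.sin x| := abs_pos.mpr hx
  have hc : |Real.cos x| < 1 := by
    rw [← sq_lt_one_iff_abs_lt_one]
    have := Real.sin_sq_add_cos_sq x
    have : 0 < Real.sin x ^ 2 := by positivity
    linarith
  have h1 := mul_le_mul_of_nonneg_right (abs_sin_nat_mul_le j x) (abs_nonneg (Real.cos x))
  have h3 : j * |Real.sin x| * |Real.cos x| < j * |Real.sin x| := by
    have : 0 < j * |Real.sin x| := by positivity
    nlinarith
  have h2 := mul_le_mul_of_nonneg_right (Real.abs_cos_le_one (j * x)) (abs_nonneg (Real.sin x))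
  push_cast
  linarith

lemma abs_sin_int_mul (k : ℤ) (x : ℝ) : |Real.sin (k * x)| = |Real.sin (k.natAbs * x)| := by
  rcases Int.natAbs_eq k with h | h
  · rw [h]; simp
  · rw [h]; simp [Real.sin_neg]

lemma sq_sin_int_mul_le (k : ℤ) (x : ℝ) :
    Real.sin (k * x) ^ 2 ≤ (k : ℝ) ^ 2 * Real.sin x ^ 2 := by
  rw [← mul_pow, sq_le_sq, abs_sin_int_mul, abs_mul, ← Int.cast_abs, ← Nat.cast_natAbs]
  exact abs_sin_nat_mul_le k.natAbs x

lemma sq_sin_int_mul_lt {k : ℤ} (hk : 2 ≤ k.natAbs) {x : ℝ} (hx : Real.sin x ≠ 0) :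
    Real.sin (k * x) ^ 2 < (k : ℝ) ^ 2 * Real.sin x ^ 2 := by
  rw [← mul_pow, sq_lt_sq, abs_sin_int_mul, abs_mul, ← Int.cast_abs, ← Nat.cast_natAbs]
  exact abs_sin_nat_mul_lt hk hx

lemma memLp_two_of_ae_bound {f : ℝ → ℝ} (hm : AEStronglyMeasurable f) {C : ℝ}
    (hC : ∀ᵐ x ∂(volume.restrict (Ioc (0:ℝ) 1)), ‖f x‖ ≤ C) :
    MemLp f 2 (volume.restrict (Ioc 0 1)) :=
  MemLp.of_bound hm.restrict C hC

lemma memLp_two_of_continuous {f : ℝ → ℝ} (hf : Continuous f) :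
    MemLp f 2 (volume.restrict (Ioc 0 1)) := by
  obtain ⟨C, hC⟩ := isCompact_Icc.exists_bound_of_continuousOn (s := Icc (0:ℝ) 1) hf.continuousOn
  refine memLp_two_of_ae_bound hf.aestronglyMeasurable (C := C) ?_
  filter_upwards [ae_restrict_mem measurableSet_Ioc] with x hx using hC x (Ioc_subset_Icc_self hx)

lemma hasSum_wirtinger_deficit {f f' : ℝ → ℝ} {K : NNReal} (hf : LipschitzWith K f)
    (hper : Function.Periodic f 1) (hd : ∀ᵐ x, HasDerivAt f (f' x) x) (hm : Measurable f')
    (w : ℝ) :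
    HasSum (fun k : ℤ => 4 * ((k:ℝ) ^ 2 * Real.sin (π * w) ^ 2 - Real.sin (k * (π * w)) ^ 2) *
        ‖unitFourierCoeff f k‖ ^ 2)
      (Real.sin (π * w) ^ 2 / π ^ 2 * (∫ x in (0:ℝ)..1, f' x ^ 2) -
        ∫ x in (0:ℝ)..1, (f (x + w) - f x) ^ 2) := by
  have hfc := hf.continuous
  have h1 : HasSum (fun k => ‖unitFourierCoeff f' k‖ ^ 2) (∫ x in (0:ℝ)..1, f' x ^ 2) := by
    refine hasSum_sq_unitFourierCoeff (memLp_two_of_ae_bound hm.aestronglyMeasurable (C := K) ?_)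
    refine ae_restrict_of_ae ?_
    filter_upwards [hd] with x hx using norm_le_of_hasDerivAt_of_lipschitzWith hf hx
  have h2 := hasSum_sq_unitFourierCoeff (f := fun x => f (x + w) - f x)
    (memLp_two_of_continuous (by fun_prop))
  have h3 := (h1.mul_left (Real.sin (π * w) ^ 2 / π ^ 2)).sub h2
  suffices hk : ∀ k : ℤ, 4 * ((k:ℝ) ^ 2 * Real.sin (π * w) ^ 2 - Real.sin (k * (π * w)) ^ 2) *
      ‖unitFourierCoeff f k‖ ^ 2 = Real.sin (π * w) ^ 2 / π ^ 2 * ‖unitFourierCoeff f' k‖ ^ 2 -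
      ‖unitFourierCoeff (fun x => f (x + w) - f x) k‖ ^ 2 by
    simpa only [hk] using h3
  intro k
  have hshift : unitFourierCoeff (fun x => f (x + w) - f x) k =
      (Complex.exp ((2 * π * k * w) * Complex.I) - 1) * unitFourierCoeff f k := by
    rw [sub_mul, one_mul, ← unitFourierCoeff_comp_add hper]
    simp only [unitFourierCoeff]
    rw [← intervalIntegral.integral_sub]
    · refine intervalIntegral.integral_congr fun x _ => ?_
      push_cast
      ring
    · exact Continuous.intervalIntegrable (by fun_prop) _ _
    · exact Continuous.intervalIntegrable (by fun_prop) _ _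
  have hn : ‖Complex.exp ((2 * π * k * w) * Complex.I) - 1‖ ^ 2 =
      4 * Real.sin (k * (π * w)) ^ 2 := by
    rw [show (2 * π * k * w : ℂ) * Complex.I = Complex.I * ((2 * π * k * w : ℝ) : ℂ) by
      push_cast; ring, Complex.norm_exp_I_mul_ofReal_sub_one, Real.norm_eq_abs, sq_abs,
      show 2 * π * k * w / 2 = k * (π * w) by ring]
    ring
  have hpi : ‖(2 * π * k * Complex.I : ℂ)‖ ^ 2 = 4 * π ^ 2 * (k:ℝ) ^ 2 := by
    simp [abs_of_pos Real.pi_pos, mul_pow]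
    norm_num
  rw [hshift, unitFourierCoeff_deriv hf hper hd hm, norm_mul _ (unitFourierCoeff f k),
    norm_mul _ (unitFourierCoeff f k), mul_pow, mul_pow, hn, hpi]
  field_simp

lemma wirtinger_difference {f f' : ℝ → ℝ} {K : NNReal} (hf : LipschitzWith K f)
    (hper : Function.Periodic f 1) (hd : ∀ᵐ x, HasDerivAt f (f' x) x) (hm : Measurable f')
    (w : ℝ) :
    ∫ x in (0:ℝ)..1, (f (x + w) - f x) ^ 2 ≤
      Real.sin (π * w) ^ 2 / π ^ 2 * ∫ x in (0:ℝ)..1, f' x ^ 2 := by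
  have h := (hasSum_wirtinger_deficit hf hper hd hm w).nonneg fun k =>
    mul_nonneg (mul_nonneg (by norm_num) (sub_nonneg.mpr (sq_sin_int_mul_le k _))) (sq_nonneg _)
  linarith

lemma unitFourierCoeff_eq_zero_of_wirtinger_eq {f f' : ℝ → ℝ} {K : NNReal}
    (hf : LipschitzWith K f)
    (hper : Function.Periodic f 1) (hd : ∀ᵐ x, HasDerivAt f (f' x) x) (hm : Measurable f')
    {w : ℝ} (hw : Real.sin (π * w) ≠ 0)
    (heq : ∫ x in (0:ℝ)..1, (f (x + w) - f x) ^ 2 =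
      Real.sin (π * w) ^ 2 / π ^ 2 * ∫ x in (0:ℝ)..1, f' x ^ 2) {k : ℤ} (hk : 2 ≤ k.natAbs) :
    unitFourierCoeff f k = 0 := by
  have h := hasSum_wirtinger_deficit hf hper hd hm w
  rw [heq, sub_self] at h
  have h0 := (hasSum_zero_iff_of_nonneg fun k => mul_nonneg (mul_nonneg (by norm_num)
    (sub_nonneg.mpr (sq_sin_int_mul_le k (π * w)))) (sq_nonneg ‖unitFourierCoeff f k‖)).mp h
  have hk0 := congrFun h0 k
  have hlt := sq_sin_int_mul_lt hk hw
  simp only [Pi.zero_apply, mul_eq_zero] at hk0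
  rcases hk0 with (h | h) | h
  · norm_num at h
  · linarith
  · simpa using h

lemma eq_trig_of_unitFourierCoeff_eq_zero {f : ℝ → ℝ} (hf : Continuous f)
    (hper : Function.Periodic f 1) (h0 : ∀ k : ℤ, 2 ≤ k.natAbs → unitFourierCoeff f k = 0) :
    ∃ A B C : ℝ, ∀ t, f t = A + B * Real.cos (2 * π * t) + C * Real.sin (2 * π * t) := by
  have : Fact ((0:ℝ) < 1) := ⟨zero_lt_one⟩
  have hg : Function.Periodic (fun x => (f x : ℂ)) 1 := fun x => by simp only [hper x]
  have hcont : Continuous (hg.lift) := by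
    have hc : Continuous fun x => (f x : ℂ) := by fun_prop
    exact continuous_coinduced_dom.mpr hc
  set F : C(AddCircle (1:ℝ), ℂ) := ⟨hg.lift, hcont⟩ with hF
  have hcoef : ∀ k, fourierCoeff F k = unitFourierCoeff f k := by
    intro k
    rw [fourierCoeff_eq_intervalIntegral _ _ 0, unitFourierCoeff]
    simp only [zero_add, div_one, one_smul, smul_eq_mul, fourier_neg_unit]
    rfl
  have hsupp : ∀ k ∉ ({-1, 0, 1} : Finset ℤ), fourierCoeff F k = 0 := by
    intro k hk
    rw [hcoef]
    refine h0 k ?_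
    simp only [Finset.mem_insert, Finset.mem_singleton] at hk
    omega
  have hsum : Summable (fourierCoeff F) := summable_of_ne_finset_zero hsupp
  refine ⟨(fourierCoeff F 0).re, (fourierCoeff F (-1)).re + (fourierCoeff F 1).re,
    (fourierCoeff F (-1)).im - (fourierCoeff F 1).im, fun t => ?_⟩
  have h1 := has_pointwise_sum_fourier_series_of_summable hsum (t : AddCircle (1:ℝ))
  have h3 := h1.unique (hasSum_sum_of_ne_finset_zero (s := {-1, 0, 1})
    fun k hk => by rw [hsupp k hk, zero_smul])
  have h4 : F (t : AddCircle (1:ℝ)) = (f t : ℂ) := rfl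
  rw [h4] at h3
  have h5 := congrArg Complex.re h3
  have e1 : fourier 1 (t : AddCircle (1:ℝ)) = Complex.exp (((2 * π * t : ℝ) : ℂ) * Complex.I) := by
    rw [fourier_coe_apply]; congr 1; push_cast; ring
  have e2 : fourier (-1) (t : AddCircle (1:ℝ)) =
      Complex.exp (((-(2 * π * t) : ℝ) : ℂ) * Complex.I) := by
    rw [fourier_coe_apply]; congr 1; push_cast; ring
  rw [Finset.sum_insert (by decide), Finset.sum_insert (by decide), Finset.sum_singleton, e1, e2,
    fourier_zero] at h5
  simp only [smul_eq_mul, Complex.add_re, Complex.mul_re, Complex.exp_ofReal_mul_I_re,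
    Complex.exp_ofReal_mul_I_im, Complex.ofReal_re, Real.cos_neg, Real.sin_neg,
    Complex.one_re, Complex.one_im] at h5
  rw [h5]
  ring

/-- `γ` is a closed curve of length one parametrized by arc length, and `D` is a measurable
representative of its derivative. -/
structure IsUnitLoop {n : ℕ} (γ D : ℝ → EuclideanSpace ℝ (Fin n)) : Prop where
  lipschitz : LipschitzWith 1 γ
  periodic : Function.Periodic γ 1
  periodic_deriv : Function.Periodic D 1
  measurable_deriv : Measurable D
  ae_hasDerivAt : ∀ᵐ t, HasDerivAt γ (D t) t
  ae_norm_deriv : ∀ᵐ t, ‖D t‖ = 1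

namespace IsUnitLoop

variable {n : ℕ} {γ D : ℝ → EuclideanSpace ℝ (Fin n)}

lemma lipschitz_apply (h : IsUnitLoop γ D) (i : Fin n) : LipschitzWith 1 fun t => γ t i := by
  refine LipschitzWith.of_dist_le_mul fun x y => ?_
  refine le_trans ?_ (h.lipschitz.dist_le_mul x y)
  rw [dist_eq_norm, dist_eq_norm]
  exact PiLp.norm_apply_le (γ x - γ y) i

lemma measurable_apply (h : IsUnitLoop γ D) (i : Fin n) : Measurable fun t => D t i :=
  (EuclideanSpace.proj (𝕜 := ℝ) i).continuous.measurable.comp h.measurable_deriv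

lemma ae_hasDerivAt_apply (h : IsUnitLoop γ D) (i : Fin n) :
    ∀ᵐ t, HasDerivAt (fun t => γ t i) (D t i) t := by
  filter_upwards [h.ae_hasDerivAt] with t ht
  exact (EuclideanSpace.proj (𝕜 := ℝ) i).hasFDerivAt.comp_hasDerivAt t ht

lemma periodic_apply (h : IsUnitLoop γ D) (i : Fin n) : Function.Periodic (fun t => γ t i) 1 :=
  fun t => by simp only [h.periodic t]

lemma wirtinger_apply (h : IsUnitLoop γ D) (w : ℝ) (i : Fin n) :
    ∫ x in (0:ℝ)..1, (γ (x + w) i - γ x i) ^ 2 ≤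
      Real.sin (π * w) ^ 2 / π ^ 2 * ∫ x in (0:ℝ)..1, D x i ^ 2 :=
  wirtinger_difference (h.lipschitz_apply i) (h.periodic_apply i) (h.ae_hasDerivAt_apply i)
    (h.measurable_apply i) w

lemma integral_norm_sq_sub (h : IsUnitLoop γ D) (w : ℝ) :
    ∫ x in (0:ℝ)..1, ‖γ (x + w) - γ x‖ ^ 2 =
      ∑ i, ∫ x in (0:ℝ)..1, (γ (x + w) i - γ x i) ^ 2 := by
  rw [← intervalIntegral.integral_finsetSum]
  · refine intervalIntegral.integral_congr fun x _ => ?_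
    simp [EuclideanSpace.norm_sq_eq]
  · intro i _
    have hc := (h.lipschitz_apply i).continuous
    exact (((hc.comp (continuous_id.add continuous_const)).sub hc).pow 2).intervalIntegrable _ _

lemma sum_integral_deriv_sq (h : IsUnitLoop γ D) :
    ∑ i, ∫ x in (0:ℝ)..1, D x i ^ 2 = 1 := by
  rw [← intervalIntegral.integral_finsetSum]
  · have : ∫ x in (0:ℝ)..1, ∑ i, D x i ^ 2 = ∫ x in (0:ℝ)..1, (1:ℝ) := by
      refine intervalIntegral.integral_congr_ae ?_
      filter_upwards [h.ae_norm_deriv] with x hx _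
      have := EuclideanSpace.norm_sq_eq (D x)
      rw [hx] at this
      simpa using this.symm
    rw [this]
    simp
  · intro i _
    rw [intervalIntegrable_iff]
    refine Measure.integrableOn_of_bounded (M := 1) (by simp) ?_ ?_
    · exact ((h.measurable_apply i).pow_const 2).aestronglyMeasurable
    · refine ae_restrict_of_ae ?_
      filter_upwards [h.ae_norm_deriv] with x hx
      have := PiLp.norm_apply_le (D x) i
      rw [hx] at this
      rw [norm_pow]
      exact pow_le_one₀ (norm_nonneg _) this

lemma integral_chord_sq_le (h : IsUnitLoop γ D) (w : ℝ) :
    ∫ x in (0:ℝ)..1, ‖γ (x + w) - γ x‖ ^ 2 ≤ (Real.sin (π * w) / π) ^ 2 := by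
  rw [h.integral_norm_sq_sub w]
  refine (Finset.sum_le_sum fun i _ => h.wirtinger_apply w i).trans ?_
  rw [← Finset.mul_sum, h.sum_integral_deriv_sq, mul_one, div_pow]

lemma exists_eq_trig (h : IsUnitLoop γ D) {w : ℝ} (hw : Real.sin (π * w) ≠ 0)
    (heq : (Real.sin (π * w) / π) ^ 2 ≤ ∫ x in (0:ℝ)..1, ‖γ (x + w) - γ x‖ ^ 2) :
    ∃ c a b : EuclideanSpace ℝ (Fin n), ∀ t,
      γ t = c + Real.cos (2 * π * t) • a + Real.sin (2 * π * t) • b := by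
  have hsum : ∑ i, ∫ x in (0:ℝ)..1, (γ (x + w) i - γ x i) ^ 2 =
      ∑ i, Real.sin (π * w) ^ 2 / π ^ 2 * ∫ x in (0:ℝ)..1, D x i ^ 2 := by
    refine le_antisymm (Finset.sum_le_sum fun i _ => h.wirtinger_apply w i) ?_
    rw [← Finset.mul_sum, h.sum_integral_deriv_sq, mul_one, ← div_pow, ← h.integral_norm_sq_sub w]
    exact heq
  have heach := (Finset.sum_eq_sum_iff_of_le fun i _ => h.wirtinger_apply w i).mp hsum
  have hex : ∀ i, ∃ A B C : ℝ, ∀ t,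
      γ t i = A + B * Real.cos (2 * π * t) + C * Real.sin (2 * π * t) := fun i =>
    eq_trig_of_unitFourierCoeff_eq_zero (h.lipschitz_apply i).continuous (h.periodic_apply i)
      fun k hk => unitFourierCoeff_eq_zero_of_wirtinger_eq (h.lipschitz_apply i)
        (h.periodic_apply i) (h.ae_hasDerivAt_apply i) (h.measurable_apply i) hw
        (heach i (Finset.mem_univ i)) hk
  choose A B C hABC using hex
  refine ⟨WithLp.toLp 2 A, WithLp.toLp 2 B, WithLp.toLp 2 C, fun t => ?_⟩
  ext i
  simp only [PiLp.add_apply, PiLp.smul_apply, smul_eq_mul]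
  rw [hABC]
  ring

lemma isCircle_of_eq_trig (h : IsUnitLoop γ D) {c a b : EuclideanSpace ℝ (Fin n)}
    (heq : ∀ t, γ t = c + Real.cos (2 * π * t) • a + Real.sin (2 * π * t) • b) :
    IsCircle (Set.range γ) := by
  have hpi := Real.pi_pos
  set v : ℝ → EuclideanSpace ℝ (Fin n) := fun t =>
    (2 * π) • (-Real.sin (2 * π * t) • a + Real.cos (2 * π * t) • b) with hv
  have hderiv : ∀ t, HasDerivAt γ (v t) t := by
    intro t
    have h0 : HasDerivAt (fun t : ℝ => 2 * π * t) (2 * π) t := by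
      simpa using (hasDerivAt_id t).const_mul (2 * π)
    have h1 := (h0.cos.smul_const a).const_add c
    have h2 := h1.fun_add (h0.sin.smul_const b)
    rw [show γ = fun t => c + Real.cos (2 * π * t) • a + Real.sin (2 * π * t) • b from funext heq]
    refine h2.congr_deriv ?_
    simp only [hv]
    module
  have hvc : Continuous v := by fun_prop
  have hnorm : ∀ t, ‖v t‖ = 1 := by
    have : (fun t => ‖v t‖) =ᵐ[volume] fun _ => (1:ℝ) := by
      filter_upwards [h.ae_hasDerivAt, h.ae_norm_deriv] with t ht1 ht2
      rw [(hderiv t).unique ht1, ht2]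
    exact congrFun ((Continuous.ae_eq_iff_eq volume hvc.norm continuous_const).mp this)
  have hb : ‖b‖ = (2 * π)⁻¹ := by
    have := hnorm 0
    simp only [hv, mul_zero, Real.sin_zero, Real.cos_zero, neg_zero, zero_smul, one_smul,
      zero_add, norm_smul, Real.norm_eq_abs] at this
    rw [abs_of_pos (by positivity)] at this
    field_simp at this ⊢
    linarith
  have ha : ‖a‖ = (2 * π)⁻¹ := by
    have := hnorm (1/4)
    rw [hv] at this
    simp only [show 2 * π * (1/4) = π / 2 by ring, Real.sin_pi_div_two, Real.cos_pi_div_two,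
      zero_smul, add_zero, norm_smul, Real.norm_eq_abs, abs_neg, abs_one, one_mul] at this
    rw [abs_of_pos (by positivity)] at this
    field_simp at this ⊢
    linarith
  have hexp : ∀ x y : ℝ, ‖x • a + y • b‖ ^ 2 =
      (x ^ 2 + y ^ 2) * ((2 * π)⁻¹) ^ 2 + 2 * (x * y) * ⟪a, b⟫ := by
    intro x y
    rw [norm_add_sq_real, norm_smul, norm_smul, ha, hb, mul_pow, mul_pow, real_inner_smul_left,
      real_inner_smul_right, Real.norm_eq_abs, Real.norm_eq_abs, sq_abs, sq_abs]
    ring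
  have hab : ⟪a, b⟫ = 0 := by
    have h1 := hnorm (1/8)
    have h2 : ‖v (1/8)‖ ^ 2 = 1 := by rw [h1]; norm_num
    simp only [hv, norm_smul, mul_pow, show 2 * π * (1/8) = π / 4 by ring] at h2
    rw [hexp, neg_sq, Real.cos_sq', Real.sin_pi_div_four, Real.cos_pi_div_four,
      Real.norm_eq_abs, sq_abs] at h2
    have h3 : (√2 / 2) ^ 2 = 1 / 2 := by
      rw [div_pow, Real.sq_sqrt (by norm_num)]; norm_num
    rw [h3, show -(√2 / 2) * (√2 / 2) = -(1/2 : ℝ) by rw [← h3]; ring] at h2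
    have h4 : (2 * π) ^ 2 * ((1 / 2 + (1 - 1 / 2)) * (2 * π)⁻¹ ^ 2) = 1 := by
      field_simp
      norm_num
    have h5 : (2 * π) ^ 2 * ⟪a, b⟫ = 0 := by
      rw [mul_add, h4] at h2
      linarith
    rcases mul_eq_zero.mp h5 with h | h
    · exact absurd h (by positivity)
    · exact h
  have hnormsq : ∀ x y : ℝ, ‖x • a + y • b‖ ^ 2 = (x ^ 2 + y ^ 2) * ((2 * π)⁻¹) ^ 2 := by
    intro x y
    rw [hexp, hab]
    ring
  refine ⟨c, (2 * π)⁻¹, Submodule.span ℝ {a, b}, by positivity, ?_, ?_⟩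
  · have hli : LinearIndependent ℝ ![a, b] := by
      rw [LinearIndependent.pair_iff]
      intro s t hst
      have := hnormsq s t
      rw [hst, norm_zero] at this
      have h2 : s ^ 2 + t ^ 2 = 0 := by
        rcases mul_eq_zero.mp (by linarith : (s ^ 2 + t ^ 2) * ((2 * π)⁻¹) ^ 2 = 0) with h | h
        · exact h
        · exact absurd h (by positivity)
      constructor <;> nlinarith [sq_nonneg s, sq_nonneg t]
    have := finrank_span_eq_card hli
    rwa [Matrix.range_cons, Matrix.range_cons, Matrix.range_empty, Set.union_empty,
      Set.singleton_union, Fintype.card_fin] at this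
  · ext x
    simp only [Set.mem_range, Set.mem_ofPred_eq, Submodule.mem_span_pair]
    constructor
    · rintro ⟨t, rfl⟩
      have e : γ t - c = Real.cos (2 * π * t) • a + Real.sin (2 * π * t) • b := by
        rw [heq]; abel
      refine ⟨?_, ⟨_, _, e.symm⟩⟩
      rw [e, ← sq_eq_sq₀ (norm_nonneg _) (by positivity), hnormsq, Real.cos_sq_add_sin_sq, one_mul]
    · rintro ⟨h1, s, t, hst⟩
      have h2 := hnormsq s t
      rw [hst, h1] at h2
      have h3 : s ^ 2 + t ^ 2 = 1 := by
        have : (((2 * π)⁻¹) ^ 2 : ℝ) ≠ 0 := by positivity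
        exact mul_right_cancel₀ this (by linarith)
      set z : ℂ := ⟨s, t⟩ with hz
      have hzn : ‖z‖ = 1 := by
        rw [← sq_eq_sq₀ (norm_nonneg _) zero_le_one, Complex.sq_norm, Complex.normSq_mk]
        linarith
      refine ⟨z.arg / (2 * π), ?_⟩
      rw [heq, show 2 * π * (z.arg / (2 * π)) = z.arg by field_simp,
        Complex.cos_arg (by rw [← norm_ne_zero_iff, hzn]; norm_num), Complex.sin_arg, hzn,
        div_one, div_one, add_assoc, hst]
      abel

end IsUnitLoop

/-- A bounded continuous minorant of `(1 - t²) ^ ((a - 1) / 2)`. -/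
def sweepDensity (a δ t : ℝ) : ℝ := √(1 - t ^ 2) ^ (a + 1) / (√(1 - t ^ 2) ^ 2 + δ)

lemma sweepDensity_nonneg {a δ : ℝ} (hδ : 0 < δ) (t : ℝ) : 0 ≤ sweepDensity a δ t := by
  unfold sweepDensity
  positivity

lemma sweepDensity_le {a δ : ℝ} (ha : 0 < a) (hδ : 0 < δ) (t : ℝ) : sweepDensity a δ t ≤ δ⁻¹ := by
  unfold sweepDensity
  have h1 : √(1 - t ^ 2) ≤ 1 := by
    rw [Real.sqrt_le_one]
    nlinarith [sq_nonneg t]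
  rw [← one_div]
  have h2 : √(1 - t ^ 2) ^ (a + 1) ≤ 1 := Real.rpow_le_one (Real.sqrt_nonneg _) h1 (by linarith)
  gcongr
  nlinarith [sq_nonneg √(1 - t ^ 2)]

lemma continuous_sweepDensity {a δ : ℝ} (ha : 0 < a) (hδ : 0 < δ) :
    Continuous (sweepDensity a δ) := by
  have h1 : Continuous fun t : ℝ => √(1 - t ^ 2) := by fun_prop
  refine Continuous.div (h1.rpow_const fun _ => Or.inr (by linarith))
    ((h1.pow 2).add continuous_const) fun t => ?_
  positivity

lemma rpow_div_le {a δ k : ℝ} (hδ : 0 < δ) (hk : 0 ≤ k) (ha : 0 < a) :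
    k ^ (a + 1) / (k ^ 2 + δ) * k ≤ k ^ a := by
  rcases hk.eq_or_lt with rfl | hk
  · simp [Real.zero_rpow ha.ne']
  · have : k ^ (a + 1) = k ^ a * k := by rw [Real.rpow_add hk, Real.rpow_one]
    rw [this, div_mul_eq_mul_div, div_le_iff₀ (by positivity)]
    nlinarith [Real.rpow_pos_of_pos hk a]

lemma tendsto_integral_sweepDensity {a : ℝ} (ha : 0 < a) :
    Filter.Tendsto (fun n : ℕ => ∫ t in (-1:ℝ)..1, sweepDensity a (1 / ((n:ℝ) + 1)) t) Filter.atTop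
      (nhds (π * ∫ w in (0:ℝ)..1, Real.sin (π * w) ^ a)) := by
  have hsub : ∀ n : ℕ, ∫ t in (-1:ℝ)..1, sweepDensity a (1 / ((n:ℝ) + 1)) t =
      ∫ θ in (0:ℝ)..π, sweepDensity a (1 / ((n:ℝ) + 1)) (Real.cos θ) * Real.sin θ := by
    intro n
    have h := intervalIntegral.integral_comp_mul_deriv (a := 0) (b := π) (f := Real.cos)
      (f' := fun θ => -Real.sin θ) (g := sweepDensity a (1 / ((n:ℝ) + 1)))
      (fun θ _ => Real.hasDerivAt_cos θ) (by fun_prop)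
      (continuous_sweepDensity ha (by positivity))
    rw [Real.cos_zero, Real.cos_pi, intervalIntegral.integral_symm (-1) 1] at h
    rw [← neg_inj, ← h, ← intervalIntegral.integral_neg]
    simp
  have htarget : π * ∫ w in (0:ℝ)..1, Real.sin (π * w) ^ a = ∫ θ in (0:ℝ)..π, Real.sin θ ^ a := by
    have := intervalIntegral.mul_integral_comp_mul_left (a := 0) (b := 1)
      (f := fun θ : ℝ => Real.sin θ ^ a) π
    simpa using this
  rw [htarget]
  simp_rw [hsub]
  have hk : ∀ θ ∈ Set.uIoc 0 π, √(1 - Real.cos θ ^ 2) = Real.sin θ ∧ 0 ≤ Real.sin θ := by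
    intro θ hθ
    rw [Set.uIoc_of_le Real.pi_pos.le] at hθ
    have h0 := Real.sin_nonneg_of_nonneg_of_le_pi hθ.1.le hθ.2
    exact ⟨by rw [← Real.sin_sq, Real.sqrt_sq h0], h0⟩
  refine intervalIntegral.tendsto_integral_filter_of_dominated_convergence
    (fun θ => Real.sin θ ^ a) (Filter.Eventually.of_forall fun n => ?_)
    (Filter.Eventually.of_forall fun n => Filter.Eventually.of_forall fun θ hθ => ?_)
    ?_ (Filter.Eventually.of_forall fun θ hθ => ?_)
  · exact (((continuous_sweepDensity ha (by positivity)).comp Real.continuous_cos).mul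
      Real.continuous_sin).aestronglyMeasurable
  · obtain ⟨h1, h0⟩ := hk θ hθ
    rw [Real.norm_eq_abs, abs_of_nonneg (mul_nonneg (sweepDensity_nonneg (by positivity) _) h0)]
    unfold sweepDensity
    rw [h1]
    exact rpow_div_le (by positivity) h0 ha
  · exact (Real.continuous_sin.rpow_const fun _ => Or.inr ha.le).intervalIntegrable _ _
  · obtain ⟨h1, h0⟩ := hk θ hθ
    unfold sweepDensity
    rw [h1]
    rcases h0.eq_or_lt with h0 | h0
    · rw [← h0]
      simp [Real.zero_rpow ha.ne']
    · have : Real.sin θ ^ a = Real.sin θ ^ (a + 1) / (Real.sin θ ^ 2 + 0) * Real.sin θ := by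
        rw [Real.rpow_add h0, Real.rpow_one]
        field_simp
        simp
      rw [this]
      refine Filter.Tendsto.mul_const _ (Filter.Tendsto.div tendsto_const_nhds
        (tendsto_const_nhds.add tendsto_one_div_add_atTop_nhds_zero_nat) (by positivity))

/-- If `x` moves from `1` to `-1` on the unit interval with `|x'| ≤ √(1 - x²) κ`, then the
integral of `√(1 - x²) ^ a κ` is at least that of a monotone sweep. -/
lemma ofReal_le_lintegral_of_sweep {a : ℝ} (ha : 0 < a) {x : ℝ → ℝ} {Y : ℝ → ℝ≥0∞}
    (hlip : ∀ ε, 0 < ε → ε < 1 / 2 → ∃ K, LipschitzOnWith K x (Set.Icc ε (1 - ε)))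
    (h0 : Filter.Tendsto x (nhdsWithin 0 (Set.Ioi 0)) (nhds 1))
    (h1 : Filter.Tendsto (fun t => x (1 - t)) (nhdsWithin 0 (Set.Ioi 0)) (nhds (-1)))
    (hY : ∀ᵐ w, w ∈ Set.Ioo (0:ℝ) 1 → ∃ d κ, HasDerivAt x d w ∧ 0 ≤ κ ∧
      |d| ≤ √(1 - x w ^ 2) * κ ∧ ENNReal.ofReal (√(1 - x w ^ 2) ^ a * κ) ≤ Y w) :
    ENNReal.ofReal (π * ∫ w in (0:ℝ)..1, Real.sin (π * w) ^ a) ≤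
      ∫⁻ w in Set.Ioc (0:ℝ) 1, Y w := by
  refine le_of_tendsto' (ENNReal.tendsto_ofReal (tendsto_integral_sweepDensity ha)) fun n => ?_
  set δ : ℝ := 1 / ((n:ℝ) + 1) with hδ
  have hδ0 : 0 < δ := by positivity
  have hgc := continuous_sweepDensity ha hδ0
  set F : ℝ → ℝ := fun t => ∫ s in (0:ℝ)..t, sweepDensity a δ s with hF
  have hFd : ∀ t, HasDerivAt F (sweepDensity a δ t) t := fun t =>
    hgc.integral_hasStrictDerivAt 0 t |>.hasDerivAt
  have hFlip : LipschitzWith δ⁻¹.toNNReal F := by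
    refine lipschitzWith_of_nnnorm_deriv_le (fun t => (hFd t).differentiableAt) fun t => ?_
    rw [(hFd t).deriv, Real.le_toNNReal_iff_coe_le (by positivity), coe_nnnorm, Real.norm_eq_abs,
      abs_of_nonneg (sweepDensity_nonneg hδ0 t)]
    exact sweepDensity_le ha hδ0 t
  have hFc : Continuous F := hFlip.continuous
  have hval : ∫ t in (-1:ℝ)..1, sweepDensity a δ t = F 1 - F (-1) := by
    rw [hF]
    exact (intervalIntegral.integral_interval_sub_left (hgc.intervalIntegrable _ _)
      (hgc.intervalIntegrable _ _)).symm
  rw [hval]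
  have hT : Filter.Tendsto (fun ε => ENNReal.ofReal (F (x ε) - F (x (1 - ε))))
      (nhdsWithin 0 (Set.Ioi 0)) (nhds (ENNReal.ofReal (F 1 - F (-1)))) :=
    ENNReal.tendsto_ofReal (((hFc.tendsto 1).comp h0).sub ((hFc.tendsto (-1)).comp h1))
  refine le_of_tendsto hT ?_
  have hev : ∀ᶠ ε : ℝ in nhdsWithin 0 (Set.Ioi 0), ε ∈ Set.Ioo (0:ℝ) (1/2) :=
    Ioo_mem_nhdsGT (by norm_num)
  filter_upwards [hev] with ε hε
  obtain ⟨K, hK⟩ := hlip ε hε.1 hε.2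
  have hle : ε ≤ 1 - ε := by linarith [hε.2]
  have hac : AbsolutelyContinuousOnInterval (fun w => F (x w)) ε (1 - ε) := by
    refine LipschitzOnWith.absolutelyContinuousOnInterval (K := δ⁻¹.toNNReal * K) ?_
    rw [Set.uIcc_of_le hle]
    exact hFlip.comp_lipschitzOnWith hK
  have hFTC := hac.integral_deriv_eq_sub
  have hII := hac.intervalIntegrable_deriv
  have e1 : F (x ε) - F (x (1 - ε)) ≤ ∫ w in Set.Ioc ε (1 - ε), |deriv (fun w => F (x w)) w| := by
    rw [← intervalIntegral.integral_of_le hle]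
    calc F (x ε) - F (x (1 - ε)) = -∫ w in ε..(1 - ε), deriv (fun w => F (x w)) w := by
          rw [hFTC]; ring
      _ ≤ |∫ w in ε..(1 - ε), deriv (fun w => F (x w)) w| := neg_le_abs _
      _ ≤ _ := intervalIntegral.abs_integral_le_integral_abs hle
  refine (ENNReal.ofReal_le_ofReal e1).trans ?_
  rw [ofReal_integral_eq_lintegral_ofReal
    ((intervalIntegrable_iff_integrableOn_Ioc_of_le hle).mp hII).abs
    (Filter.Eventually.of_forall fun _ => abs_nonneg _)]
  refine le_trans ?_ (lintegral_mono_set (s := Set.Ioc ε (1 - ε)) (t := Set.Ioc 0 1)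
    (Set.Ioc_subset_Ioc hε.1.le (by linarith [hε.1])))
  refine lintegral_mono_ae ?_
  rw [ae_restrict_iff' measurableSet_Ioc]
  filter_upwards [hY] with w hw hwm
  obtain ⟨d, κ, hd, hκ, hdκ, hle⟩ := hw ⟨by linarith [hwm.1, hε.1], by linarith [hwm.2, hε.1]⟩
  refine le_trans (ENNReal.ofReal_le_ofReal ?_) hle
  have : HasDerivAt (fun w => F (x w)) (sweepDensity a δ (x w) * d) w := (hFd (x w)).comp w hd
  rw [this.deriv, abs_mul, abs_of_nonneg (sweepDensity_nonneg hδ0 _)]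
  calc sweepDensity a δ (x w) * |d| ≤ sweepDensity a δ (x w) * (√(1 - x w ^ 2) * κ) :=
        mul_le_mul_of_nonneg_left hdκ (sweepDensity_nonneg hδ0 _)
    _ = sweepDensity a δ (x w) * √(1 - x w ^ 2) * κ := by ring
    _ ≤ _ := mul_le_mul_of_nonneg_right (rpow_div_le hδ0 (Real.sqrt_nonneg _) ha) hκ

section InnerProduct

variable {F : Type*} [NormedAddCommGroup F] [InnerProductSpace ℝ F]

lemma norm_projPerp_sq {v : F} (hv : ‖v‖ = 1) (x : F) :
    ‖projPerp v x‖ ^ 2 = ‖x‖ ^ 2 - ⟪v, x⟫ ^ 2 := by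
  unfold projPerp
  rw [norm_sub_sq_real, hv, norm_smul, hv, inner_smul_right, real_inner_comm v x, Real.norm_eq_abs]
  simp only [one_pow, div_one, mul_one, sq_abs]
  rw [real_inner_comm]
  ring

lemma projPerp_neg (v x : F) : projPerp v (-x) = -projPerp v x := by
  unfold projPerp
  rw [inner_neg_right, neg_div, neg_smul]
  abel

lemma norm_projPerp_neg (v x : F) : ‖projPerp v (-x)‖ = ‖projPerp v x‖ := by
  rw [projPerp_neg, norm_neg]

/-- The spherical Cauchy–Schwarz inequality for the components orthogonal to `x`. -/
lemma abs_inner_mul_sub_le {v e : F} (hv : ‖v‖ = 1) (he : ‖e‖ = 1) {x : F} (hx : x ≠ 0) :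
    |⟪e, v⟫ * ‖x‖ ^ 2 - ⟪e, x⟫ * ⟪x, v⟫| ≤ ‖projPerp e x‖ * ‖projPerp v x‖ := by
  have hx0 : 0 < ‖x‖ := norm_pos_iff.mpr hx
  have key : ∀ w : F, ‖w‖ = 1 → ‖‖x‖ ^ 2 • w - ⟪w, x⟫ • x‖ = ‖x‖ * ‖projPerp w x‖ := by
    intro w hw
    rw [← sq_eq_sq₀ (norm_nonneg _) (by positivity), mul_pow, norm_projPerp_sq hw,
      norm_sub_sq_real, norm_smul, norm_smul, hw, inner_smul_left, inner_smul_right, mul_pow,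
      mul_pow, Real.norm_eq_abs, Real.norm_eq_abs, sq_abs, sq_abs]
    simp only [conj_trivial]
    ring
  have hcs := abs_real_inner_le_norm (‖x‖ ^ 2 • e - ⟪e, x⟫ • x) (‖x‖ ^ 2 • v - ⟪v, x⟫ • x)
  rw [key e he, key v hv] at hcs
  have hin : ⟪‖x‖ ^ 2 • e - ⟪e, x⟫ • x, ‖x‖ ^ 2 • v - ⟪v, x⟫ • x⟫ =
      ‖x‖ ^ 2 * (⟪e, v⟫ * ‖x‖ ^ 2 - ⟪e, x⟫ * ⟪x, v⟫) := by
    simp only [inner_sub_left, inner_sub_right, real_inner_smul_left, real_inner_smul_right,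
      real_inner_self_eq_norm_sq]
    rw [real_inner_comm x v]
    ring
  rw [hin, abs_mul, abs_of_pos (by positivity : 0 < ‖x‖ ^ 2)] at hcs
  have h2 : 0 < ‖x‖ ^ 2 := by positivity
  refine le_of_mul_le_mul_left ?_ h2
  linarith

lemma sqrt_one_sub_inner_div_sq {v : F} (hv : ‖v‖ = 1) {x : F} (hx : x ≠ 0) :
    √(1 - (⟪v, x⟫ / ‖x‖) ^ 2) = ‖projPerp v x‖ / ‖x‖ := by
  have hx0 : 0 < ‖x‖ := norm_pos_iff.mpr hx
  rw [Real.sqrt_eq_iff_mul_self_eq (by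
    rw [div_pow, sub_nonneg, div_le_one (by positivity)]
    linarith [norm_projPerp_sq hv x, sq_nonneg ‖projPerp v x‖]) (by positivity), ← sq, div_pow,
    div_pow, norm_projPerp_sq hv]
  field_simp

lemma hasDerivAt_inner_div_norm {f : ℝ → F} {v : F} {t : ℝ} (hf : HasDerivAt f v t)
    (h0 : f t ≠ 0) (e : F) :
    HasDerivAt (fun s => ⟪e, f s⟫ / ‖f s‖)
      ((⟪e, v⟫ * ‖f t‖ ^ 2 - ⟪e, f t⟫ * ⟪f t, v⟫) / ‖f t‖ ^ 3) t := by
  have hx0 : 0 < ‖f t‖ := norm_pos_iff.mpr h0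
  have h1 : HasDerivAt (fun s => ⟪e, f s⟫) ⟪e, v⟫ t := by
    simpa using (hasDerivAt_const t e).inner ℝ hf
  have h2 : HasDerivAt (fun s => ‖f s‖) (⟪f t, v⟫ / ‖f t‖) t := by
    have h3 := (hf.norm_sq).sqrt (by positivity)
    simp only [Real.sqrt_sq (norm_nonneg _)] at h3
    refine h3.congr_deriv ?_
    field_simp
  refine (h1.fun_div h2 hx0.ne').congr_deriv ?_
  field_simp

lemma tendsto_inner_div_norm {f : ℝ → F} {v : F} (hf : HasDerivAt f v 0) (hf0 : f 0 = 0)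
    (hv : ‖v‖ = 1) (e : F) :
    Filter.Tendsto (fun t => ⟪e, f t⟫ / ‖f t‖) (nhdsWithin 0 (Set.Ioi 0)) (nhds ⟪e, v⟫) := by
  have h1 : Filter.Tendsto (fun t : ℝ => t⁻¹ • f t) (nhdsWithin 0 (Set.Ioi 0)) (nhds v) := by
    have := hf.tendsto_slope_zero_right
    simpa [hf0] using this
  have h2 : Filter.Tendsto (fun t : ℝ => ⟪e, t⁻¹ • f t⟫ / ‖t⁻¹ • f t‖)
      (nhdsWithin 0 (Set.Ioi 0)) (nhds (⟪e, v⟫ / ‖v‖)) :=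
    (tendsto_const_nhds.inner h1).div h1.norm (by rw [hv]; exact one_ne_zero)
  rw [hv, div_one] at h2
  refine h2.congr' ?_
  filter_upwards [self_mem_nhdsWithin] with t ht
  have ht0 : (0:ℝ) < t := ht
  rw [real_inner_smul_right, norm_smul, Real.norm_eq_abs, abs_of_pos (inv_pos.mpr ht0),
    mul_div_mul_left _ _ (inv_pos.mpr ht0).ne']

lemma lipschitzOnWith_inner_div_norm {f : ℝ → F} (hf : LipschitzWith 1 f) {e : F}
    (he : ‖e‖ = 1) {a b : ℝ} (h0 : ∀ t ∈ Set.Icc a b, f t ≠ 0) :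
    ∃ K, LipschitzOnWith K (fun t => ⟪e, f t⟫ / ‖f t‖) (Set.Icc a b) := by
  rcases (Set.Icc a b).eq_empty_or_nonempty with hemp | hne
  · exact ⟨0, by rw [hemp]; simp⟩
  obtain ⟨t₀, ht₀, hmin⟩ := isCompact_Icc.exists_isMinOn hne hf.continuous.norm.continuousOn
  have hm : 0 < ‖f t₀‖ := norm_pos_iff.mpr (h0 t₀ ht₀)
  refine ⟨(2 / ‖f t₀‖).toNNReal, LipschitzOnWith.of_dist_le_mul fun s hs t ht => ?_⟩
  rw [Real.coe_toNNReal _ (by positivity), Real.dist_eq, Real.dist_eq]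
  have hs0 : 0 < ‖f s‖ := norm_pos_iff.mpr (h0 s hs)
  have ht0 : 0 < ‖f t‖ := norm_pos_iff.mpr (h0 t ht)
  have hsm : ‖f t₀‖ ≤ ‖f s‖ := hmin hs
  have hd : ‖f s - f t‖ ≤ |s - t| := by
    have := hf.dist_le_mul s t
    rwa [dist_eq_norm, Real.dist_eq, NNReal.coe_one, one_mul] at this
  have hsplit : ⟪e, f s⟫ / ‖f s‖ - ⟪e, f t⟫ / ‖f t‖ =
      (⟪e, f s - f t⟫ + ⟪e, f t⟫ / ‖f t‖ * (‖f t‖ - ‖f s‖)) / ‖f s‖ := by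
    rw [inner_sub_right]
    field_simp
    ring
  have h1 : |⟪e, f s - f t⟫| ≤ |s - t| := by
    refine (abs_real_inner_le_norm _ _).trans ?_
    rwa [he, one_mul]
  have h2 : |⟪e, f t⟫ / ‖f t‖| ≤ 1 := by
    rw [abs_div, abs_norm, div_le_one ht0]
    refine (abs_real_inner_le_norm _ _).trans ?_
    rw [he, one_mul]
  have h3 : |‖f t‖ - ‖f s‖| ≤ |s - t| := by
    rw [abs_sub_comm]
    exact (abs_norm_sub_norm_le _ _).trans hd
  rw [hsplit, abs_div, abs_norm, div_mul_eq_mul_div (2:ℝ)]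
  refine div_le_div₀ (mul_nonneg zero_le_two (abs_nonneg _)) ?_ hm hsm
  refine (abs_add_le _ _).trans ?_
  rw [abs_mul]
  nlinarith [abs_nonneg (‖f t‖ - ‖f s‖)]

end InnerProduct

namespace IsUnitLoop

variable {n : ℕ} {γ D : ℝ → EuclideanSpace ℝ (Fin n)}

lemma ofReal_le_lintegral_sweep (h : IsUnitLoop γ D) {a : ℝ} (ha : 0 < a) {u : ℝ}
    (hu : HasDerivAt γ (D u) u) (hu1 : ‖D u‖ = 1)
    (hinj : ∀ w ∈ Set.Ioo (0:ℝ) 1, γ (u + w) - γ u ≠ 0) :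
    ENNReal.ofReal (π * ∫ w in (0:ℝ)..1, Real.sin (π * w) ^ a) ≤
      ∫⁻ w in Set.Ioc (0:ℝ) 1, ENNReal.ofReal (‖projPerp (D u) (γ (u + w) - γ u)‖ ^ a *
        ‖projPerp (D (u + w)) (γ (u + w) - γ u)‖ / ‖γ (u + w) - γ u‖ ^ (a + 2)) := by
  have hshift : ∀ᵐ w, HasDerivAt γ (D (u + w)) (u + w) ∧ ‖D (u + w)‖ = 1 :=
    (measurePreserving_add_left volume u).quasiMeasurePreserving.ae
      (h.ae_hasDerivAt.and h.ae_norm_deriv)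
  have hlip : LipschitzWith 1 fun w => γ (u + w) - γ u := by
    refine LipschitzWith.of_dist_le_mul fun s t => ?_
    have := h.lipschitz.dist_le_mul (u + s) (u + t)
    rwa [dist_add_left, ← dist_sub_right _ _ (γ u)] at this
  have hu' : ⟪D u, D u⟫ = 1 := by rw [real_inner_self_eq_norm_sq, hu1, one_pow]
  refine ofReal_le_lintegral_of_sweep (x := fun w => ⟪D u, γ (u + w) - γ u⟫ / ‖γ (u + w) - γ u‖) ha
    (fun ε h1 h2 => lipschitzOnWith_inner_div_norm hlip hu1 fun t ht =>
      hinj t ⟨by linarith [ht.1], by linarith [ht.2]⟩) ?_ ?_ ?_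
  · have hd : HasDerivAt (fun w => γ (u + w) - γ u) (D u) 0 := by
      refine HasDerivAt.sub_const _ (HasDerivAt.comp_const_add u 0 ?_)
      rwa [add_zero]
    have := tendsto_inner_div_norm hd (by simp) hu1 (D u)
    rwa [hu'] at this
  · have hd : HasDerivAt (fun t => γ (u + (1 - t)) - γ u) (-D u) 0 := by
      have hp : (fun t => γ (u + (1 - t)) - γ u) = fun t => γ (u - t) - γ u := by
        funext t
        rw [show u + (1 - t) = (u - t) + 1 by ring, h.periodic]
      rw [hp]
      refine HasDerivAt.sub_const _ (HasDerivAt.comp_const_sub u 0 ?_)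
      rwa [sub_zero]
    have := tendsto_inner_div_norm hd (by simp [h.periodic u]) (by rw [norm_neg, hu1]) (D u)
    rwa [inner_neg_right, hu'] at this
  · filter_upwards [hshift] with w hw hwm
    have hne := hinj w hwm
    have hr : 0 < ‖γ (u + w) - γ u‖ := norm_pos_iff.mpr hne
    have hd : HasDerivAt (fun w => γ (u + w) - γ u) (D (u + w)) w :=
      HasDerivAt.sub_const _ (HasDerivAt.comp_const_add u w hw.1)
    refine ⟨_, ‖projPerp (D (u + w)) (γ (u + w) - γ u)‖ / ‖γ (u + w) - γ u‖ ^ 2,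
      hasDerivAt_inner_div_norm hd hne (D u), by positivity, ?_, ?_⟩
    · rw [sqrt_one_sub_inner_div_sq hu1 hne, abs_div, abs_of_pos (by positivity :
        0 < ‖γ (u + w) - γ u‖ ^ 3), div_mul_div_comm, ← pow_succ']
      exact div_le_div_of_nonneg_right (abs_inner_mul_sub_le hw.2 hu1 hne) (by positivity)
    · rw [sqrt_one_sub_inner_div_sq hu1 hne, Real.div_rpow (norm_nonneg _) (norm_nonneg _),
        div_mul_div_comm, Real.rpow_add hr, Real.rpow_two]

end IsUnitLoop

lemma weighted_amgm_three {p q t A B r : ℝ} (hq : 0 < q) (hp : p < 2 * q) (hpq : q + 1 ≤ p)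
    (ht : 0 < t) (hA : 0 ≤ A) (hB : 0 ≤ B) (hr : 0 < r) :
    t ^ (p - q - 1) * (A ^ (2 * q - p) * B / r ^ (2 * q - p + 2)) ≤
      (2 * q - p) / q * (A ^ q / r ^ p) + 1 / q * (B ^ q / r ^ p) +
        (p - q - 1) / q * (t ^ q * r ^ (2 * q - p)) := by
  have h := Real.geom_mean_le_arith_mean3_weighted (w₁ := (2 * q - p) / q) (w₂ := 1 / q)
    (w₃ := (p - q - 1) / q) (p₁ := A ^ q / r ^ p) (p₂ := B ^ q / r ^ p)
    (p₃ := t ^ q * r ^ (2 * q - p)) (div_nonneg (by linarith) hq.le) (by positivity)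
    (div_nonneg (by linarith) hq.le) (by positivity) (by positivity) (by positivity)
    (by field_simp; ring)
  refine le_of_eq_of_le ?_ h
  rw [Real.div_rpow (by positivity) (by positivity), Real.div_rpow (by positivity) (by positivity),
    Real.mul_rpow (by positivity) (by positivity), ← Real.rpow_mul hA, ← Real.rpow_mul hB,
    ← Real.rpow_mul hr.le, ← Real.rpow_mul hr.le, ← Real.rpow_mul hr.le, ← Real.rpow_mul ht.le,
    mul_div_cancel₀ _ hq.ne', mul_div_cancel₀ _ hq.ne', mul_div_cancel₀ _ hq.ne', Real.rpow_one]
  have hexp : r ^ (p * ((2 * q - p) / q)) * r ^ (p * (1 / q)) =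
      r ^ (2 * q - p + 2) * r ^ ((2 * q - p) * ((p - q - 1) / q)) := by
    rw [← Real.rpow_add hr, ← Real.rpow_add hr]
    congr 1
    field_simp
    ring
  have h1 := Real.rpow_pos_of_pos hr (p * ((2 * q - p) / q))
  have h2 := Real.rpow_pos_of_pos hr (p * (1 / q))
  have h3 := Real.rpow_pos_of_pos hr (2 * q - p + 2)
  generalize r ^ (p * ((2 * q - p) / q)) = R₁ at *
  generalize r ^ (p * (1 / q)) = R₂ at *
  generalize r ^ ((2 * q - p) * ((p - q - 1) / q)) = R₃ at *
  generalize r ^ (2 * q - p + 2) = R₄ at *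
  rw [div_mul_div_comm, hexp]
  have h4 : R₃ ≠ 0 := by
    rintro rfl
    rw [mul_zero] at hexp
    exact (mul_pos h1 h2).ne' hexp
  field_simp

lemma rpow_le_tangent {a r s : ℝ} (ha : 0 < a) (ha2 : a ≤ 2) (hr : 0 ≤ r) (hs : 0 < s) :
    r ^ a ≤ s ^ (a - 2) * (a / 2 * r ^ 2 + (1 - a / 2) * s ^ 2) := by
  have h := Real.geom_mean_le_arith_mean2_weighted (w₁ := a / 2) (w₂ := 1 - a / 2)
    (p₁ := r ^ 2) (p₂ := s ^ 2) (by linarith) (by linarith) (by positivity) (by positivity)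
    (by ring)
  refine le_trans (le_of_eq ?_) (mul_le_mul_of_nonneg_left h (Real.rpow_nonneg hs.le _))
  rw [← Real.rpow_natCast_mul hr, ← Real.rpow_natCast_mul hs.le, mul_left_comm, ← Real.rpow_add hs]
  push_cast
  rw [show a - 2 + 2 * (1 - a / 2) = 0 by ring, Real.rpow_zero, mul_one]
  congr 1
  ring

lemma lintegral_comp_add_of_periodic {f : ℝ → ℝ≥0∞} (hf : Function.Periodic f 1) (w : ℝ) :
    ∫⁻ x in Set.Ioc (0:ℝ) 1, f (x + w) = ∫⁻ x in Set.Ioc (0:ℝ) 1, f x := by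
  have h1 : ∫⁻ x in Set.Ioc (0:ℝ) 1, f (x + w) = ∫⁻ x in Set.Ioc w (w + 1), f x := by
    have := (measurePreserving_add_right volume w).setLIntegral_comp_preimage_emb
      (measurableEmbedding_addRight w) f (Set.Ioc w (w + 1))
    simpa using this
  rw [h1]
  have h0 := isAddFundamentalDomain_Ioc (zero_lt_one' ℝ) 0
  rw [zero_add] at h0
  exact (isAddFundamentalDomain_Ioc (zero_lt_one' ℝ) w).setLIntegral_eq h0 f
    hf.map_vadd_zmultiples

lemma lintegral_comp_neg_of_periodic {f : ℝ → ℝ≥0∞} (hf : Function.Periodic f 1) :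
    ∫⁻ x in Set.Ioc (0:ℝ) 1, f (-x) = ∫⁻ x in Set.Ioc (0:ℝ) 1, f x := by
  have h1 : ∫⁻ x in Set.Ioc (0:ℝ) 1, f (-x) = ∫⁻ x in Set.Ico (-1:ℝ) 0, f x := by
    have := (Measure.measurePreserving_neg (volume : Measure ℝ)).setLIntegral_comp_preimage_emb
      (MeasurableEquiv.neg ℝ).measurableEmbedding f (Set.Ico (-1) 0)
    simpa using this
  have h2 : ∫⁻ x in Set.Ico (-1:ℝ) 0, f x = ∫⁻ x in Set.Ioc (-1:ℝ) 0, f x := by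
    rw [restrict_Ico_eq_restrict_Ioc]
  rw [h1, h2]
  have h0 := isAddFundamentalDomain_Ioc (zero_lt_one' ℝ) 0
  have h3 := isAddFundamentalDomain_Ioc (zero_lt_one' ℝ) (-1)
  rw [zero_add] at h0
  rw [neg_add_cancel] at h3
  exact h3.setLIntegral_eq h0 f hf.map_vadd_zmultiples

lemma ofReal_mul_le_three {c c₁ c₂ c₃ y x₁ x₂ x₃ : ℝ} (hc : 0 ≤ c) (h₁ : 0 ≤ c₁) (h₂ : 0 ≤ c₂)
    (h₃ : 0 ≤ c₃) (hx₁ : 0 ≤ x₁) (hx₂ : 0 ≤ x₂) (hx₃ : 0 ≤ x₃)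
    (h : c * y ≤ c₁ * x₁ + c₂ * x₂ + c₃ * x₃) :
    ENNReal.ofReal c * ENNReal.ofReal y ≤ ENNReal.ofReal c₁ * ENNReal.ofReal x₁ +
      ENNReal.ofReal c₂ * ENNReal.ofReal x₂ + ENNReal.ofReal c₃ * ENNReal.ofReal x₃ := by
  rw [← ENNReal.ofReal_mul hc, ← ENNReal.ofReal_mul h₁, ← ENNReal.ofReal_mul h₂,
    ← ENNReal.ofReal_mul h₃, ← ENNReal.ofReal_add (by positivity) (by positivity),
    ← ENNReal.ofReal_add (by positivity) (by positivity)]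
  exact ENNReal.ofReal_le_ofReal h

lemma mul_lintegral_le_three {μ : Measure ℝ} {X₁ X₂ X₃ Y : ℝ → ℝ≥0∞} {c c₁ c₂ c₃ : ℝ≥0∞}
    (hc : c ≠ ∞) (h₁ : Measurable X₁) (h₂ : Measurable X₂) (h₃ : Measurable X₃)
    (h : ∀ᵐ w ∂μ, c * Y w ≤ c₁ * X₁ w + c₂ * X₂ w + c₃ * X₃ w) :
    c * ∫⁻ w, Y w ∂μ ≤ c₁ * (∫⁻ w, X₁ w ∂μ) + c₂ * (∫⁻ w, X₂ w ∂μ) + c₃ * ∫⁻ w, X₃ w ∂μ := by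
  rw [← lintegral_const_mul' _ _ hc, ← lintegral_const_mul _ h₁, ← lintegral_const_mul _ h₂,
    ← lintegral_const_mul _ h₃, ← lintegral_add_left (h₁.const_mul _),
    ← lintegral_add_left (f := fun w => c₁ * X₁ w + c₂ * X₂ w)
      ((h₁.const_mul c₁).add (h₂.const_mul c₂))]
  exact lintegral_mono_ae h

/-- The tangent-point energy for a prescribed choice of unit tangents. -/
def tangentPointEnergy {n : ℕ} (γ D : ℝ → EuclideanSpace ℝ (Fin n)) (p q : ℝ) : ℝ≥0∞ :=
  ∫⁻ u in Set.Ioc (0:ℝ) 1, ∫⁻ w in Set.Ioc (0:ℝ) 1,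
    ENNReal.ofReal (‖projPerp (D u) (γ (u + w) - γ u)‖ ^ q / ‖γ (u + w) - γ u‖ ^ p)

/-- The integral of the `a`-th power of the chord lengths. -/
def chordEnergy {n : ℕ} (γ : ℝ → EuclideanSpace ℝ (Fin n)) (a : ℝ) : ℝ≥0∞ :=
  ∫⁻ u in Set.Ioc (0:ℝ) 1, ∫⁻ w in Set.Ioc (0:ℝ) 1, ENNReal.ofReal (‖γ (u + w) - γ u‖ ^ a)

lemma ae_mem_Ioo_zero_one : ∀ᵐ w ∂(volume.restrict (Set.Ioc (0:ℝ) 1)), w ∈ Set.Ioo (0:ℝ) 1 := by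
  rw [← restrict_Ioo_eq_restrict_Ioc]
  exact ae_restrict_mem measurableSet_Ioo

lemma lintegral_chord_circle {a : ℝ} (ha : 0 < a) :
    ∫⁻ w in Set.Ioc (0:ℝ) 1, ENNReal.ofReal ((Real.sin (π * w) / π) ^ a) =
      ENNReal.ofReal (π ^ (-a) * ∫ w in (0:ℝ)..1, Real.sin (π * w) ^ a) := by
  have hnn : ∀ w ∈ Set.Ioc (0:ℝ) 1, 0 ≤ Real.sin (π * w) := fun w hw =>
    Real.sin_nonneg_of_nonneg_of_le_pi (mul_nonneg Real.pi_pos.le hw.1.le)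
      (by nlinarith [Real.pi_pos, hw.2])
  have hc : Continuous fun w : ℝ => (Real.sin (π * w) / π) ^ a :=
    Continuous.rpow_const (by fun_prop) fun _ => Or.inr ha.le
  have h1 : π ^ (-a) * ∫ w in (0:ℝ)..1, Real.sin (π * w) ^ a =
      ∫ w in Set.Ioc (0:ℝ) 1, (Real.sin (π * w) / π) ^ a := by
    rw [← intervalIntegral.integral_const_mul, intervalIntegral.integral_of_le zero_le_one]
    refine setIntegral_congr_fun measurableSet_Ioc fun w hw => ?_
    rw [Real.div_rpow (hnn w hw) Real.pi_pos.le, Real.rpow_neg Real.pi_pos.le, div_eq_inv_mul]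
  rw [h1, ofReal_integral_eq_lintegral_ofReal]
  · exact ((intervalIntegrable_iff_integrableOn_Ioc_of_le zero_le_one).mp
      (hc.intervalIntegrable 0 1))
  · rw [Filter.EventuallyLE, ae_restrict_iff' measurableSet_Ioc]
    exact Filter.Eventually.of_forall fun w hw =>
      Real.rpow_nonneg (div_nonneg (hnn w hw) Real.pi_pos.le) _

namespace IsUnitLoop

variable {n : ℕ} {γ D : ℝ → EuclideanSpace ℝ (Fin n)}

lemma measurable_left (h : IsUnitLoop γ D) :
    Measurable fun z : ℝ × ℝ => ‖projPerp (D z.1) (γ (z.1 + z.2) - γ z.1)‖ := by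
  have h1 := h.lipschitz.continuous.measurable
  have h2 := h.measurable_deriv
  unfold projPerp
  fun_prop

lemma measurable_right (h : IsUnitLoop γ D) :
    Measurable fun z : ℝ × ℝ => ‖projPerp (D (z.1 + z.2)) (γ (z.1 + z.2) - γ z.1)‖ := by
  have h1 := h.lipschitz.continuous.measurable
  have h2 := h.measurable_deriv
  unfold projPerp
  fun_prop

lemma measurable_chord (h : IsUnitLoop γ D) :
    Measurable fun z : ℝ × ℝ => ‖γ (z.1 + z.2) - γ z.1‖ := by
  have h1 := h.lipschitz.continuous.measurable
  fun_prop

lemma tangentPointEnergy_eq_right (h : IsUnitLoop γ D) (p q : ℝ) :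
    tangentPointEnergy γ D p q = ∫⁻ u in Set.Ioc (0:ℝ) 1, ∫⁻ w in Set.Ioc (0:ℝ) 1,
      ENNReal.ofReal (‖projPerp (D (u + w)) (γ (u + w) - γ u)‖ ^ q /
        ‖γ (u + w) - γ u‖ ^ p) := by
  set g : ℝ → ℝ → ℝ≥0∞ := fun u w =>
    ENNReal.ofReal (‖projPerp (D u) (γ (u + w) - γ u)‖ ^ q / ‖γ (u + w) - γ u‖ ^ p) with hg
  have hgm : Measurable fun z : ℝ × ℝ => g z.1 z.2 :=
    ((h.measurable_left.pow_const q).div (h.measurable_chord.pow_const p)).ennreal_ofReal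
  have hg1 : ∀ w, Function.Periodic (fun u => g u w) 1 := by
    intro w u
    simp only [hg]
    rw [show u + 1 + w = u + w + 1 by ring, h.periodic, h.periodic, h.periodic_deriv]
  have hg2 : ∀ u, Function.Periodic (fun w => g u w) 1 := by
    intro u w
    simp only [hg]
    rw [← add_assoc, h.periodic]
  have hr : ∀ u w, ENNReal.ofReal (‖projPerp (D (u + w)) (γ (u + w) - γ u)‖ ^ q /
      ‖γ (u + w) - γ u‖ ^ p) = g (u + w) (-w) := by
    intro u w
    simp only [hg]
    rw [add_neg_cancel_right, ← norm_projPerp_neg, neg_sub, norm_sub_rev (γ u)]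
  simp_rw [hr]
  rw [lintegral_lintegral_swap]
  · simp_rw [fun w => lintegral_comp_add_of_periodic (hg1 (-w)) w]
    rw [lintegral_lintegral_swap]
    · simp_rw [fun u => lintegral_comp_neg_of_periodic (hg2 u)]
      rfl
    · exact (hgm.comp (measurable_snd.prodMk measurable_fst.neg)).aemeasurable
  · exact (hgm.comp ((measurable_fst.add measurable_snd).prodMk measurable_snd.neg)).aemeasurable

lemma ofReal_le_energies (h : IsUnitLoop γ D)
    (hinj : ∀ u, ∀ w ∈ Set.Ioo (0:ℝ) 1, γ (u + w) - γ u ≠ 0) {p q : ℝ} (hq : 0 < q)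
    (hp : p < 2 * q) (hpq : q + 1 ≤ p) :
    ENNReal.ofReal (π ^ (p - q) * ∫ w in (0:ℝ)..1, Real.sin (π * w) ^ (2 * q - p)) ≤
      ENNReal.ofReal ((2 * q - p + 1) / q) * tangentPointEnergy γ D p q +
        ENNReal.ofReal ((p - q - 1) / q * π ^ q) * chordEnergy γ (2 * q - p) := by
  have hpi := Real.pi_pos
  obtain ⟨X₁, hX₁⟩ : ∃ X : ℝ → ℝ → ℝ≥0∞, ∀ u w, X u w = ENNReal.ofReal
      (‖projPerp (D u) (γ (u + w) - γ u)‖ ^ q / ‖γ (u + w) - γ u‖ ^ p) := ⟨_, fun _ _ => rfl⟩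
  obtain ⟨X₂, hX₂⟩ : ∃ X : ℝ → ℝ → ℝ≥0∞, ∀ u w, X u w = ENNReal.ofReal
      (‖projPerp (D (u + w)) (γ (u + w) - γ u)‖ ^ q / ‖γ (u + w) - γ u‖ ^ p) :=
    ⟨_, fun _ _ => rfl⟩
  obtain ⟨X₃, hX₃⟩ : ∃ X : ℝ → ℝ → ℝ≥0∞, ∀ u w, X u w = ENNReal.ofReal
      (‖γ (u + w) - γ u‖ ^ (2 * q - p)) := ⟨_, fun _ _ => rfl⟩
  have hm₁ : Measurable fun z : ℝ × ℝ => X₁ z.1 z.2 := by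
    simp_rw [hX₁]
    exact ((h.measurable_left.pow_const q).div (h.measurable_chord.pow_const p)).ennreal_ofReal
  have hm₂ : Measurable fun z : ℝ × ℝ => X₂ z.1 z.2 := by
    simp_rw [hX₂]
    exact ((h.measurable_right.pow_const q).div (h.measurable_chord.pow_const p)).ennreal_ofReal
  have hm₃ : Measurable fun z : ℝ × ℝ => X₃ z.1 z.2 := by
    simp_rw [hX₃]
    exact (h.measurable_chord.pow_const (2 * q - p)).ennreal_ofReal
  have hm₁' : ∀ u, Measurable (X₁ u) := fun u => hm₁.comp measurable_prodMk_left
  have hm₂' : ∀ u, Measurable (X₂ u) := fun u => hm₂.comp measurable_prodMk_left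
  have hm₃' : ∀ u, Measurable (X₃ u) := fun u => hm₃.comp measurable_prodMk_left
  have hpt : ∀ u, ∀ w ∈ Set.Ioo (0:ℝ) 1, ENNReal.ofReal (π ^ (p - q - 1)) *
      ENNReal.ofReal (‖projPerp (D u) (γ (u + w) - γ u)‖ ^ (2 * q - p) *
        ‖projPerp (D (u + w)) (γ (u + w) - γ u)‖ / ‖γ (u + w) - γ u‖ ^ (2 * q - p + 2)) ≤
      ENNReal.ofReal ((2 * q - p) / q) * X₁ u w + ENNReal.ofReal (1 / q) * X₂ u w + ENNReal.ofReal ((p - q - 1) / q * π ^ q) * X₃ u w := by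
    intro u w hw
    have hr : 0 < ‖γ (u + w) - γ u‖ := norm_pos_iff.mpr (hinj u w hw)
    have h1 : 0 ≤ (2 * q - p) / q := div_nonneg (by linarith) hq.le
    have h3 : 0 ≤ (p - q - 1) / q := div_nonneg (by linarith) hq.le
    rw [hX₁, hX₂, hX₃]
    refine ofReal_mul_le_three (by positivity) h1 (by positivity) (by positivity) (by positivity)
      (by positivity) (by positivity) ?_
    rw [mul_assoc ((p - q - 1) / q)]
    exact weighted_amgm_three hq hp hpq hpi (norm_nonneg _) (norm_nonneg _) hr
  have hinner : ∀ᵐ u, ENNReal.ofReal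
        (π ^ (p - q) * ∫ w in (0:ℝ)..1, Real.sin (π * w) ^ (2 * q - p)) ≤
      ENNReal.ofReal ((2 * q - p) / q) * (∫⁻ w in Set.Ioc (0:ℝ) 1, X₁ u w) + ENNReal.ofReal (1 / q) * (∫⁻ w in Set.Ioc (0:ℝ) 1, X₂ u w) +
        ENNReal.ofReal ((p - q - 1) / q * π ^ q) * ∫⁻ w in Set.Ioc (0:ℝ) 1, X₃ u w := by
    filter_upwards [h.ae_hasDerivAt, h.ae_norm_deriv] with u hu hu1
    have h1 := h.ofReal_le_lintegral_sweep (a := 2 * q - p) (by linarith) hu hu1 (hinj u)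
    have h2 : π ^ (p - q) = π ^ (p - q - 1) * π := by
      rw [← Real.rpow_add_one hpi.ne', sub_add_cancel]
    rw [h2, mul_assoc, ENNReal.ofReal_mul (by positivity)]
    have h3 := mul_lintegral_le_three (c := ENNReal.ofReal (π ^ (p - q - 1))) ENNReal.ofReal_ne_top
      (hm₁' u) (hm₂' u) (hm₃' u) (ae_mem_Ioo_zero_one.mono (hpt u))
    exact (mul_le_mul' le_rfl h1).trans h3
  have hI₁ : Measurable fun u => ∫⁻ w in Set.Ioc (0:ℝ) 1, X₁ u w := hm₁.lintegral_prod_right'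
  have hI₂ : Measurable fun u => ∫⁻ w in Set.Ioc (0:ℝ) 1, X₂ u w := hm₂.lintegral_prod_right'
  have hI₃ : Measurable fun u => ∫⁻ w in Set.Ioc (0:ℝ) 1, X₃ u w := hm₃.lintegral_prod_right'
  have hfin := mul_lintegral_le_three (c := 1) (Y := fun _ => ENNReal.ofReal
    (π ^ (p - q) * ∫ w in (0:ℝ)..1, Real.sin (π * w) ^ (2 * q - p))) ENNReal.one_ne_top hI₁ hI₂ hI₃
    (ae_restrict_of_ae (s := Set.Ioc (0:ℝ) 1) (by simpa only [one_mul] using hinner))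
  have e₂ : ∫⁻ u in Set.Ioc (0:ℝ) 1, ∫⁻ w in Set.Ioc (0:ℝ) 1, X₂ u w =
      tangentPointEnergy γ D p q := by
    simp_rw [hX₂]
    exact (h.tangentPointEnergy_eq_right p q).symm
  have e₁ : ∫⁻ u in Set.Ioc (0:ℝ) 1, ∫⁻ w in Set.Ioc (0:ℝ) 1, X₁ u w =
      tangentPointEnergy γ D p q := by
    simp_rw [hX₁]
    rfl
  have e₃ : ∫⁻ u in Set.Ioc (0:ℝ) 1, ∫⁻ w in Set.Ioc (0:ℝ) 1, X₃ u w =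
      chordEnergy γ (2 * q - p) := by
    simp_rw [hX₃]
    rfl
  rw [e₁, e₂, e₃, ← add_mul, ← ENNReal.ofReal_add (div_nonneg (by linarith) hq.le) (by positivity),
    ← add_div] at hfin
  simpa using hfin

lemma lintegral_chord_le (h : IsUnitLoop γ D) {a : ℝ} (ha : 0 < a) (ha2 : a ≤ 2) {w : ℝ}
    (hw : w ∈ Set.Ioo (0:ℝ) 1) :
    ∫⁻ u in Set.Ioc (0:ℝ) 1, ENNReal.ofReal (‖γ (u + w) - γ u‖ ^ a) ≤
      ENNReal.ofReal ((Real.sin (π * w) / π) ^ (a - 2) *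
        (a / 2 * (∫ u in (0:ℝ)..1, ‖γ (u + w) - γ u‖ ^ 2) +
          (1 - a / 2) * (Real.sin (π * w) / π) ^ 2)) := by
  have hpi := Real.pi_pos
  have hs : 0 < Real.sin (π * w) / π :=
    div_pos (Real.sin_pos_of_pos_of_lt_pi (mul_pos hpi hw.1) (by nlinarith [hw.2])) hpi
  set s := Real.sin (π * w) / π
  have hc := h.lipschitz.continuous
  have hcr : Continuous fun u => ‖γ (u + w) - γ u‖ ^ 2 := by fun_prop
  have hI : ∫ u in (0:ℝ)..1, s ^ (a - 2) * (a / 2 * ‖γ (u + w) - γ u‖ ^ 2 + (1 - a / 2) * s ^ 2) =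
      s ^ (a - 2) * (a / 2 * (∫ u in (0:ℝ)..1, ‖γ (u + w) - γ u‖ ^ 2) +
          (1 - a / 2) * s ^ 2) := by
    rw [intervalIntegral.integral_const_mul, intervalIntegral.integral_add
      ((hcr.const_mul _).intervalIntegrable _ _) intervalIntegrable_const,
      intervalIntegral.integral_const_mul]
    simp
  rw [← hI, intervalIntegral.integral_of_le zero_le_one, ofReal_integral_eq_lintegral_ofReal]
  · exact lintegral_mono fun u => ENNReal.ofReal_le_ofReal
      (rpow_le_tangent ha ha2 (norm_nonneg _) hs)
  · refine ((intervalIntegrable_iff_integrableOn_Ioc_of_le zero_le_one).mp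
      (Continuous.intervalIntegrable ?_ 0 1))
    exact ((hcr.const_mul _).add continuous_const).const_mul _
  · refine Filter.Eventually.of_forall fun u => ?_
    have : 0 ≤ 1 - a / 2 := by linarith
    positivity

lemma chordEnergy_eq_swap (h : IsUnitLoop γ D) (a : ℝ) :
    chordEnergy γ a = ∫⁻ w in Set.Ioc (0:ℝ) 1, ∫⁻ u in Set.Ioc (0:ℝ) 1,
      ENNReal.ofReal (‖γ (u + w) - γ u‖ ^ a) := by
  unfold chordEnergy
  exact lintegral_lintegral_swap (h.measurable_chord.pow_const a).ennreal_ofReal.aemeasurable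

lemma chordEnergy_le (h : IsUnitLoop γ D) {a : ℝ} (ha : 0 < a) (ha2 : a ≤ 2) :
    chordEnergy γ a ≤ ENNReal.ofReal (π ^ (-a) * ∫ w in (0:ℝ)..1, Real.sin (π * w) ^ a) := by
  have hpi := Real.pi_pos
  rw [h.chordEnergy_eq_swap, ← lintegral_chord_circle ha]
  refine lintegral_mono_ae ?_
  filter_upwards [ae_mem_Ioo_zero_one] with w hw
  refine (h.lintegral_chord_le ha ha2 hw).trans ?_
  have hs : 0 < Real.sin (π * w) / π :=
    div_pos (Real.sin_pos_of_pos_of_lt_pi (mul_pos hpi hw.1) (by nlinarith [hw.2])) hpi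
  refine ENNReal.ofReal_le_ofReal ?_
  have h1 := h.integral_chord_sq_le w
  calc _ ≤ (Real.sin (π * w) / π) ^ (a - 2) * (Real.sin (π * w) / π) ^ 2 := by
        refine mul_le_mul_of_nonneg_left ?_ (by positivity)
        nlinarith
    _ = _ := by rw [← Real.rpow_two, ← Real.rpow_add hs, sub_add_cancel]

lemma exists_chord_sq_ge (h : IsUnitLoop γ D) {a : ℝ} (ha : 0 < a) (ha2 : a ≤ 2)
    (hge : ENNReal.ofReal (π ^ (-a) * ∫ w in (0:ℝ)..1, Real.sin (π * w) ^ a) ≤ chordEnergy γ a) :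
    ∃ w ∈ Set.Ioo (0:ℝ) 1,
      (Real.sin (π * w) / π) ^ 2 ≤ ∫ x in (0:ℝ)..1, ‖γ (x + w) - γ x‖ ^ 2 := by
  by_contra! hlt
  have hpi := Real.pi_pos
  refine absurd hge (not_le.mpr ?_)
  have htop : chordEnergy γ a ≠ ∞ := ne_top_of_le_ne_top ENNReal.ofReal_ne_top
    (h.chordEnergy_le ha ha2)
  rw [h.chordEnergy_eq_swap] at htop ⊢
  rw [← lintegral_chord_circle ha]
  refine lintegral_strict_mono (by simp) ?_ htop ?_
  · refine Measurable.aemeasurable (Measurable.ennreal_ofReal ?_)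
    exact Measurable.pow_const (by fun_prop) a
  · filter_upwards [ae_mem_Ioo_zero_one] with w hw
    refine (h.lintegral_chord_le ha ha2 hw).trans_lt ?_
    have hs : 0 < Real.sin (π * w) / π :=
      div_pos (Real.sin_pos_of_pos_of_lt_pi (mul_pos hpi hw.1) (by nlinarith [hw.2])) hpi
    refine (ENNReal.ofReal_lt_ofReal_iff (by positivity)).mpr ?_
    calc _ < (Real.sin (π * w) / π) ^ (a - 2) * (Real.sin (π * w) / π) ^ 2 := by
          refine mul_lt_mul_of_pos_left ?_ (by positivity)
          nlinarith [hlt w hw]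
      _ = _ := by rw [← Real.rpow_two, ← Real.rpow_add hs, sub_add_cancel]

end IsUnitLoop

lemma real_inner_complex (z w : ℂ) : ⟪z, w⟫ = z.re * w.re + z.im * w.im := by
  rw [Complex.inner]
  simp [Complex.mul_re]
  ring

lemma norm_sq_sub_inner_sq_of_circle {z z' d : ℂ} {ρ : ℝ} (hρ : 0 < ρ) (hz : ‖z‖ = ρ)
    (hz' : ‖z'‖ = 1) (horth : ⟪z, z'⟫ = 0) (hd : ‖z + d‖ = ρ) :
    ‖d‖ ^ 2 - ⟪z', d⟫ ^ 2 = (‖d‖ ^ 2 / (2 * ρ)) ^ 2 := by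
  have h1 : ‖z‖ ^ 2 = ρ ^ 2 := by rw [hz]
  have h2 : ‖z'‖ ^ 2 = 1 := by rw [hz', one_pow]
  have h3 : ‖z + d‖ ^ 2 = ρ ^ 2 := by rw [hd]
  obtain ⟨a, b⟩ := z
  obtain ⟨x, y⟩ := z'
  obtain ⟨s, t⟩ := d
  rw [real_inner_complex] at horth ⊢
  rw [Complex.sq_norm, Complex.normSq_apply] at h1 h2 h3
  rw [Complex.sq_norm, Complex.normSq_apply]
  simp only [Complex.add_re, Complex.add_im] at *
  have h4 : s * s + t * t = -2 * (a * s + b * t) := by linarith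
  have h5 : a = -(b * x - a * y) * y := by linear_combination (-a) * h2 + x * horth
  have h6 : b = (b * x - a * y) * x := by linear_combination (-b) * h2 + y * horth
  have h7 : (b * x - a * y) ^ 2 = ρ ^ 2 := by
    linear_combination h1 + (a ^ 2 + b ^ 2) * h2 - (a * x + b * y) * horth
  have h8 : a * s + b * t = (b * x - a * y) * (x * t - y * s) := by
    linear_combination s * h5 + t * h6
  have h9 : s * s + t * t - (x * s + y * t) ^ 2 = (x * t - y * s) ^ 2 := by
    linear_combination (-(s * s + t * t)) * h2
  have h10 : (s * s + t * t) ^ 2 = (2 * ρ) ^ 2 * (x * t - y * s) ^ 2 := by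
    rw [h4, h8]
    linear_combination 4 * (x * t - y * s) ^ 2 * h7
  rw [h9, div_pow, h10]
  field_simp

lemma abs_im_div_of_circle {z z' : ℂ} {ρ : ℝ} (hz : ‖z‖ = ρ) (hz' : ‖z'‖ = 1)
    (horth : ⟪z, z'⟫ = 0) : |(z' / z).im| = 1 / ρ := by
  have h1 : (z' / z).re = 0 := by
    rw [real_inner_complex] at horth
    rw [Complex.div_re, ← add_div, mul_comm z'.re, mul_comm z'.im, horth, zero_div]
  have h2 : ‖z' / z‖ = 1 / ρ := by rw [norm_div, hz, hz']
  rw [← h2, ← sq_eq_sq₀ (abs_nonneg _) (norm_nonneg _), Complex.sq_norm, Complex.normSq_apply, h1,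
    sq_abs]
  ring

/-- An injective loop of length one on a circle of radius `ρ` in the plane covers at most the
whole circle. -/
lemma one_le_two_pi_mul_of_injOn {z z' : ℝ → ℂ} {ρ : ℝ} (hρ : 0 < ρ) (hz : ∀ t, ‖z t‖ = ρ)
    (hinj : Set.InjOn z (Set.Ico 0 1))
    (hd : ∀ᵐ t, HasDerivAt z (z' t) t ∧ ‖z' t‖ = 1 ∧ ⟪z t, z' t⟫ = 0) :
    1 ≤ 2 * π * ρ := by
  have hbad : ∀ᵐ t, t ∈ Set.Ico (0:ℝ) 1 → z t ∈ Complex.slitPlane := by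
    have hs : Set.Subsingleton {t | t ∈ Set.Ico (0:ℝ) 1 ∧ z t ∉ Complex.slitPlane} := by
      have key : ∀ t, z t ∉ Complex.slitPlane → (z t).arg = π := by
        intro t ht
        by_contra h
        exact ht (Complex.mem_slitPlane_iff_arg.mpr ⟨h, by
          rw [← norm_ne_zero_iff, hz]
          exact hρ.ne'⟩)
      intro s hs t ht
      exact hinj hs.1 ht.1 (Complex.ext_norm_arg (by rw [hz, hz]) (by rw [key s hs.2, key t ht.2]))
    have := hs.measure_zero (volume : Measure ℝ)
    rw [ae_iff]
    simpa only [Classical.not_imp] using this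
  obtain ⟨M, hMae, hMm, hM⟩ := (hd.and hbad).exists_measurable_mem
  set s : Set ℝ := Set.Ico 0 1 ∩ M
  have hder : ∀ t ∈ s, HasDerivWithinAt (fun t => (z t).arg) (z' t / z t).im s t := by
    intro t ht
    have h1 := ((hM t ht.2).1.1).clog_real ((hM t ht.2).2 ht.1)
    have h2 := Complex.imCLM.hasFDerivAt.comp_hasDerivAt t h1
    exact (h2.congr_of_eventuallyEq (Filter.Eventually.of_forall fun x => by
      simp [Complex.log_im])).hasDerivWithinAt
  have hinj' : Set.InjOn (fun t => (z t).arg) s := fun x hx y hy hxy =>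
    hinj hx.1 hy.1 (Complex.ext_norm_arg (by rw [hz, hz]) hxy)
  have hmain := lintegral_image_eq_lintegral_abs_deriv_mul (measurableSet_Ico.inter hMm) hder hinj'
    fun _ => 1
  have hleft : ∫⁻ _ in (fun t => (z t).arg) '' s, (1:ℝ≥0∞) ≤ ENNReal.ofReal (2 * π) := by
    rw [setLIntegral_one]
    refine (measure_mono (t := Set.Ioc (-π) π) ?_).trans ?_
    · rintro _ ⟨t, _, rfl⟩
      exact Complex.arg_mem_Ioc _
    · rw [Real.volume_Ioc]
      exact ENNReal.ofReal_le_ofReal (by linarith)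
  have hright : ∫⁻ t in s, ENNReal.ofReal |(z' t / z t).im| * 1 = ENNReal.ofReal (1 / ρ) := by
    rw [setLIntegral_congr_fun (g := fun _ => ENNReal.ofReal (1 / ρ))
      (measurableSet_Ico.inter hMm) fun t ht => ?_]
    · rw [setLIntegral_const, measure_inter_conull (mem_ae_iff.mp hMae)]
      simp
    · simp only []
      rw [abs_im_div_of_circle (hz t) (hM t ht.2).1.2.1 (hM t ht.2).1.2.2, mul_one]
  rw [hright] at hmain
  rw [hmain] at hleft
  have := (ENNReal.ofReal_le_ofReal_iff (by positivity)).mp hleft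
  rwa [div_le_iff₀ hρ] at this

/-- Planar coordinates on a two-dimensional subspace. -/
lemma exists_planar_coordinates {n : ℕ} {V : Submodule ℝ (EuclideanSpace ℝ (Fin n))}
    (hV : Module.finrank ℝ V = 2) :
    ∃ L : EuclideanSpace ℝ (Fin n) →L[ℝ] ℂ, ∀ x ∈ V, ∀ y ∈ V, ⟪L x, L y⟫ = ⟪x, y⟫ := by
  let Φ : V ≃ₗᵢ[ℝ] ℂ :=
    (stdOrthonormalBasis ℝ V).equiv Complex.orthonormalBasisOneI (finCongr hV)
  refine ⟨(Φ.toContinuousLinearEquiv : V →L[ℝ] ℂ) ∘L V.orthogonalProjectionOnto,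
    fun x hx y hy => ?_⟩
  simp [Submodule.orthogonalProjectionOnto_mem_subspace_eq_self (K := V) ⟨x, hx⟩,
    Submodule.orthogonalProjectionOnto_mem_subspace_eq_self (K := V) ⟨y, hy⟩]

namespace IsUnitLoop

variable {n : ℕ} {γ D : ℝ → EuclideanSpace ℝ (Fin n)}

lemma chord_ne_zero (hinj : ∀ s t, γ s = γ t → ∃ k : ℤ, s - t = k) (u : ℝ) :
    ∀ w ∈ Set.Ioo (0:ℝ) 1, γ (u + w) - γ u ≠ 0 := by
  intro w hw h
  obtain ⟨k, hk⟩ := hinj _ _ (sub_eq_zero.mp h)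
  rw [add_sub_cancel_left] at hk
  rw [hk] at hw
  have h1 : (0:ℤ) < k := by exact_mod_cast hw.1
  have h2 : k < (1:ℤ) := by exact_mod_cast hw.2
  omega

lemma exists_radius_of_isCircle (h : IsUnitLoop γ D)
    (hinj : ∀ s t, γ s = γ t → ∃ k : ℤ, s - t = k) (hC : IsCircle (Set.range γ)) :
    ∃ ρ : ℝ, 0 < ρ ∧ 1 ≤ 2 * π * ρ ∧ ∀ᵐ u, ∀ w,
      ‖projPerp (D u) (γ (u + w) - γ u)‖ = ‖γ (u + w) - γ u‖ ^ 2 / (2 * ρ) := by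
  obtain ⟨c, ρ, V, hρ, hV, hS⟩ := hC
  have hmem : ∀ t, ‖γ t - c‖ = ρ ∧ γ t - c ∈ V := fun t => by
    have : γ t ∈ Set.range γ := ⟨t, rfl⟩
    rw [hS] at this
    exact this
  obtain ⟨L, hL⟩ := exists_planar_coordinates hV
  have hLn : ∀ x ∈ V, ‖L x‖ = ‖x‖ := fun x hx => by
    rw [← sq_eq_sq₀ (norm_nonneg _) (norm_nonneg _), ← real_inner_self_eq_norm_sq,
      ← real_inner_self_eq_norm_sq, hL x hx x hx]
  have hDV : ∀ t, HasDerivAt γ (D t) t → D t ∈ V := by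
    intro t ht
    have h1 := ht.sub_const c
    have h2 := V.starProjection.hasFDerivAt.comp_hasDerivAt t h1
    have h3 : (V.starProjection ∘ fun t => γ t - c) = fun t => γ t - c :=
      funext fun t => Submodule.starProjection_eq_self_iff.mpr (hmem t).2
    rw [h3] at h2
    exact Submodule.starProjection_eq_self_iff.mp (h2.unique h1)
  have horth : ∀ t, HasDerivAt γ (D t) t → ⟪γ t - c, D t⟫ = 0 := by
    intro t ht
    have h1 := (ht.sub_const c).norm_sq
    have h2 : (fun t => ‖γ t - c‖ ^ 2) = fun _ => ρ ^ 2 := funext fun t => by rw [(hmem t).1]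
    rw [h2] at h1
    have := h1.unique (hasDerivAt_const t _)
    linarith
  refine ⟨ρ, hρ, ?_, ?_⟩
  · refine one_le_two_pi_mul_of_injOn (z := fun t => L (γ t - c)) (z' := fun t => L (D t)) hρ
      (fun t => by rw [hLn _ (hmem t).2, (hmem t).1]) ?_ ?_
    · intro s hs t ht hst
      have h1 : ‖L (γ s - c) - L (γ t - c)‖ = ‖(γ s - c) - (γ t - c)‖ := by
        rw [← map_sub]
        exact hLn _ (V.sub_mem (hmem s).2 (hmem t).2)
      rw [sub_eq_zero.mpr hst, norm_zero, sub_sub_sub_cancel_right] at h1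
      obtain ⟨k, hk⟩ := hinj s t (sub_eq_zero.mp (norm_eq_zero.mp h1.symm))
      have h2 : (k:ℝ) < 1 := by linarith [hs.2, ht.1]
      have h3 : (-1:ℝ) < k := by linarith [hs.1, ht.2]
      have h4 : k < (1:ℤ) := by exact_mod_cast h2
      have h5 : (-1:ℤ) < k := by exact_mod_cast h3
      have h6 : k = 0 := by omega
      rw [h6, Int.cast_zero] at hk
      linarith
    · filter_upwards [h.ae_hasDerivAt, h.ae_norm_deriv] with t ht ht1
      refine ⟨L.hasFDerivAt.comp_hasDerivAt t (ht.sub_const c), ?_, ?_⟩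
      · rw [hLn _ (hDV t ht), ht1]
      · rw [hL _ (hmem t).2 _ (hDV t ht), horth t ht]
  · filter_upwards [h.ae_hasDerivAt, h.ae_norm_deriv] with u hu hu1 w
    have hΔ : γ (u + w) - γ u ∈ V := by
      have := V.sub_mem (hmem (u + w)).2 (hmem u).2
      rwa [sub_sub_sub_cancel_right] at this
    rw [← sq_eq_sq₀ (norm_nonneg _) (by positivity), norm_projPerp_sq hu1, ← hLn _ hΔ,
      ← hL _ (hDV u hu) _ hΔ]
    refine norm_sq_sub_inner_sq_of_circle (z := L (γ u - c)) hρ ?_ ?_ ?_ ?_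
    · rw [hLn _ (hmem u).2, (hmem u).1]
    · rw [hLn _ (hDV u hu), hu1]
    · rw [hL _ (hmem u).2 _ (hDV u hu), horth u hu]
    · rw [← map_add, show γ u - c + (γ (u + w) - γ u) = γ (u + w) - c by abel,
        hLn _ (hmem (u + w)).2, (hmem (u + w)).1]

lemma tangentPointEnergy_le_of_isCircle (h : IsUnitLoop γ D)
    (hinj : ∀ s t, γ s = γ t → ∃ k : ℤ, s - t = k) (hC : IsCircle (Set.range γ)) {p q : ℝ}
    (hq : 0 < q) : tangentPointEnergy γ D p q ≤
      ENNReal.ofReal (π ^ q) * chordEnergy γ (2 * q - p) := by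
  obtain ⟨ρ, hρ, hρ1, hA⟩ := h.exists_radius_of_isCircle hinj hC
  unfold tangentPointEnergy chordEnergy
  rw [← lintegral_const_mul' _ _ ENNReal.ofReal_ne_top]
  refine lintegral_mono_ae (ae_restrict_of_ae ?_)
  filter_upwards [hA] with u hu
  rw [← lintegral_const_mul' _ _ ENNReal.ofReal_ne_top]
  refine lintegral_mono_ae ?_
  filter_upwards [ae_mem_Ioo_zero_one] with w hw
  have hr : 0 < ‖γ (u + w) - γ u‖ := norm_pos_iff.mpr (chord_ne_zero hinj u w hw)
  rw [hu w, ← ENNReal.ofReal_mul (by positivity)]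
  refine ENNReal.ofReal_le_ofReal ?_
  rw [Real.rpow_sub hr, ← mul_div_assoc]
  refine div_le_div_of_nonneg_right ?_ (by positivity)
  rw [Real.rpow_mul hr.le, Real.rpow_two, ← Real.mul_rpow (by positivity) (by positivity)]
  refine Real.rpow_le_rpow (by positivity) ?_ hq.le
  rw [div_le_iff₀ (by positivity)]
  nlinarith [sq_nonneg ‖γ (u + w) - γ u‖]

end IsUnitLoop

lemma ofReal_le_of_le_weighted {K c d : ℝ} {E : ℝ≥0∞} (hK : 0 ≤ K) (hc : 0 < c) (hd : 0 ≤ d)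
    (hcd : c + d = 1)
    (h : ENNReal.ofReal K ≤ ENNReal.ofReal c * E + ENNReal.ofReal (d * K)) :
    ENNReal.ofReal K ≤ E := by
  rcases eq_or_ne E ⊤ with rfl | hE
  · exact le_top
  · lift E to NNReal using hE
    rw [← ENNReal.ofReal_coe_nnreal, ← ENNReal.ofReal_mul hc.le,
      ← ENNReal.ofReal_add (by positivity) (by positivity),
      ENNReal.ofReal_le_ofReal_iff (by positivity)] at h
    rw [← ENNReal.ofReal_coe_nnreal, ENNReal.ofReal_le_ofReal_iff (by positivity)]
    refine le_of_mul_le_mul_left ?_ hc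
    linear_combination h + K * hcd

lemma ofReal_le_of_ofReal_mul_add_le {K c d : ℝ} {E : ℝ≥0∞} (hK : 0 ≤ K) (hc : 0 ≤ c)
    (hd : 0 < d) (hcd : c + d = 1)
    (h : ENNReal.ofReal K ≤ ENNReal.ofReal (c * K) + ENNReal.ofReal d * E) :
    ENNReal.ofReal K ≤ E := by
  refine ofReal_le_of_le_weighted hK hd hc (by rw [add_comm, hcd]) ?_
  rwa [add_comm]

namespace IsUnitLoop

variable {n : ℕ} {γ D : ℝ → EuclideanSpace ℝ (Fin n)} {p q : ℝ}

lemma integral_sin_rpow_nonneg (a : ℝ) : 0 ≤ ∫ w in (0:ℝ)..1, Real.sin (π * w) ^ a := by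
  refine intervalIntegral.integral_nonneg zero_le_one fun w hw => Real.rpow_nonneg ?_ _
  exact Real.sin_nonneg_of_nonneg_of_le_pi (mul_nonneg Real.pi_pos.le hw.1)
    (mul_le_of_le_one_right Real.pi_pos.le hw.2)

lemma pi_rpow_mul (p q S : ℝ) :
    π ^ q * (π ^ (-(2 * q - p)) * S) = π ^ (p - q) * S := by
  rw [← mul_assoc, ← Real.rpow_add Real.pi_pos]
  congr 2
  ring

lemma ofReal_le_tangentPointEnergy (h : IsUnitLoop γ D)
    (hinj : ∀ s t, γ s = γ t → ∃ k : ℤ, s - t = k) (hq : 0 < q) (hp1 : 2 * q - 2 ≤ p)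
    (hp2 : p < 2 * q) (hp3 : q + 1 ≤ p) :
    ENNReal.ofReal (π ^ (p - q) * ∫ w in (0:ℝ)..1, Real.sin (π * w) ^ (2 * q - p)) ≤
      tangentPointEnergy γ D p q := by
  have hS := integral_sin_rpow_nonneg (2 * q - p)
  have hd : 0 ≤ (p - q - 1) / q := div_nonneg (by linarith) hq.le
  refine ofReal_le_of_le_weighted (c := (2 * q - p + 1) / q) (d := (p - q - 1) / q)
    (by positivity) (div_pos (by linarith) hq) hd (by field_simp; ring) ?_
  refine (h.ofReal_le_energies (chord_ne_zero hinj) hq hp2 hp3).trans ?_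
  gcongr
  calc _ ≤ ENNReal.ofReal ((p - q - 1) / q * π ^ q) * ENNReal.ofReal _ := by
        gcongr
        exact h.chordEnergy_le (by linarith) (by linarith)
    _ = _ := by
        rw [← ENNReal.ofReal_mul (by positivity), mul_assoc, pi_rpow_mul]

lemma isCircle_of_tangentPointEnergy_eq (h : IsUnitLoop γ D)
    (hinj : ∀ s t, γ s = γ t → ∃ k : ℤ, s - t = k) (hq : 0 < q) (hp1 : 2 * q - 2 ≤ p)
    (hp2 : p < 2 * q) (hp3 : q + 1 < p)
    (heq : tangentPointEnergy γ D p q =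
      ENNReal.ofReal (π ^ (p - q) * ∫ w in (0:ℝ)..1, Real.sin (π * w) ^ (2 * q - p))) :
    IsCircle (Set.range γ) := by
  have hS := integral_sin_rpow_nonneg (2 * q - p)
  have hd : 0 < (p - q - 1) / q := div_pos (by linarith) hq
  have hc : 0 < (2 * q - p + 1) / q := div_pos (by linarith) hq
  have h1 := h.ofReal_le_energies (chord_ne_zero hinj) hq hp2 hp3.le
  rw [heq, ← ENNReal.ofReal_mul hc.le, ENNReal.ofReal_mul hd.le, mul_assoc] at h1
  have h2 := ofReal_le_of_ofReal_mul_add_le (by positivity) hc.le hd (by field_simp; ring) h1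
  rw [← pi_rpow_mul, ENNReal.ofReal_mul (by positivity),
    ENNReal.mul_le_mul_iff_right (by simp [Real.rpow_pos_of_pos Real.pi_pos])
      ENNReal.ofReal_ne_top] at h2
  obtain ⟨w, hw, hle⟩ := h.exists_chord_sq_ge (by linarith) (by linarith) h2
  obtain ⟨c, a, b, htrig⟩ := h.exists_eq_trig (Real.sin_pos_of_pos_of_lt_pi
    (mul_pos Real.pi_pos hw.1) (mul_lt_of_lt_one_right Real.pi_pos hw.2)).ne' hle
  exact h.isCircle_of_eq_trig htrig

lemma tangentPointEnergy_eq_of_isCircle (h : IsUnitLoop γ D)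
    (hinj : ∀ s t, γ s = γ t → ∃ k : ℤ, s - t = k) (hq : 0 < q) (hp1 : 2 * q - 2 ≤ p)
    (hp2 : p < 2 * q) (hp3 : q + 1 ≤ p) (hC : IsCircle (Set.range γ)) :
    tangentPointEnergy γ D p q =
      ENNReal.ofReal (π ^ (p - q) * ∫ w in (0:ℝ)..1, Real.sin (π * w) ^ (2 * q - p)) := by
  refine le_antisymm ?_ (h.ofReal_le_tangentPointEnergy hinj hq hp1 hp2 hp3)
  calc _ ≤ ENNReal.ofReal (π ^ q) * chordEnergy γ (2 * q - p) :=
        h.tangentPointEnergy_le_of_isCircle hinj hC hq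
    _ ≤ ENNReal.ofReal (π ^ q) * ENNReal.ofReal _ := by
        gcongr
        exact h.chordEnergy_le (by linarith) (by linarith)
    _ = _ := by rw [← ENNReal.ofReal_mul (by positivity), pi_rpow_mul]

end IsUnitLoop

namespace ClosedCurve

variable {n : ℕ} {γ : ClosedCurve n}

lemma intervalIntegrable_deriv (γ : ClosedCurve n) (a b : ℝ) :
    IntervalIntegrable γ.deriv' volume a b := by
  refine γ.deriv'_periodic.intervalIntegrable₀ one_ne_zero ?_ a b
  rw [intervalIntegrable_iff_integrableOn_Icc_of_le zero_le_one]
  exact γ.integrableOn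

lemma ae_hasDerivAt (γ : ClosedCurve n) : ∀ᵐ t, HasDerivAt γ.toFun (γ.deriv' t) t := by
  have hloc : LocallyIntegrable γ.deriv' volume := by
    intro x
    refine ⟨Set.Icc (x - 1) (x + 1), Icc_mem_nhds (by linarith) (by linarith), ?_⟩
    rw [← intervalIntegrable_iff_integrableOn_Icc_of_le (by linarith)]
    exact γ.intervalIntegrable_deriv _ _
  have hfun : γ.toFun = fun t => γ.toFun 0 + ∫ s in (0:ℝ)..t, γ.deriv' s :=
    funext γ.eq_integral
  filter_upwards [LocallyIntegrable.ae_hasDerivAt_integral hloc] with t ht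
  rw [hfun]
  exact (ht 0).const_add _

lemma IsArclength.lipschitzWith (h : γ.IsArclength) : LipschitzWith 1 γ.toFun := by
  refine LipschitzWith.of_dist_le_mul fun s t => ?_
  rw [dist_eq_norm, γ.eq_integral s, γ.eq_integral t, add_sub_add_left_eq_sub,
    intervalIntegral.integral_interval_sub_left (γ.intervalIntegrable_deriv _ _)
      (γ.intervalIntegrable_deriv _ _), NNReal.coe_one, Real.dist_eq]
  refine intervalIntegral.norm_integral_le_of_norm_le_const_ae ?_
  filter_upwards [h] with x hx _
  exact hx.le

lemma ae_deriv_eq (γ : ClosedCurve n) : ∀ᵐ t, γ.deriv' t = deriv γ.toFun t := by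
  filter_upwards [γ.ae_hasDerivAt] with t ht
  exact ht.deriv.symm

lemma IsArclength.isUnitLoop (h : γ.IsArclength) : IsUnitLoop γ.toFun (deriv γ.toFun) where
  lipschitz := h.lipschitzWith
  periodic := γ.periodic
  periodic_deriv := fun t => by
    rw [← deriv_comp_add_const, funext γ.periodic]
  measurable_deriv := measurable_deriv _
  ae_hasDerivAt := by
    filter_upwards [γ.ae_hasDerivAt] with t ht
    exact ht.differentiableAt.hasDerivAt
  ae_norm_deriv := by
    filter_upwards [γ.ae_deriv_eq, h] with t ht ht1
    rw [← ht, ht1]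

lemma IsArclength.TP_eq_tangentPointEnergy (h : γ.IsArclength) (p q : ℝ) :
    TP p q γ = tangentPointEnergy γ.toFun (deriv γ.toFun) p q := by
  refine lintegral_congr_ae (ae_restrict_of_ae ?_)
  filter_upwards [γ.ae_deriv_eq, h] with u hu hu1
  refine lintegral_congr_ae (ae_restrict_of_ae ?_)
  have hshift : ∀ᵐ w, ‖γ.deriv' (u + w)‖ = 1 :=
    (measurePreserving_add_left volume u).quasiMeasurePreserving.ae h
  filter_upwards [hshift] with w hw
  rw [hu1, hw, mul_one, mul_one, hu]

end ClosedCurve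

/-- **The case `p ∈ [2q−2, 2q) ∩ (q+1, 2q)`** (Theorem 5.12): for `q > 1` and arc-length
parametrized injective `γ`, `TP^{(p,q)}(γ) ≥ π^{p−q} ∫₀¹ sin(πw)^{2q−p} dw`, with
equality iff the image of `γ` is a circle. -/
theorem tp_below_geometric {n : ℕ} (p q : ℝ) (hq : 1 < q) (hp1 : 2 * q - 2 ≤ p)
    (hp2 : p < 2 * q) (hp3 : q + 1 < p) (γ : ClosedCurve n) (hinj : γ.IsInj)
    (harc : γ.IsArclength) :
    ENNReal.ofReal (π ^ (p - q) * ∫ w in (0:ℝ)..1, Real.sin (π * w) ^ (2 * q - p))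
        ≤ TP p q γ ∧
    (TP p q γ =
        ENNReal.ofReal (π ^ (p - q) * ∫ w in (0:ℝ)..1, Real.sin (π * w) ^ (2 * q - p)) ↔
      IsCircle (Set.range γ.toFun)) := by
  have hq0 : 0 < q := by linarith
  rw [harc.TP_eq_tangentPointEnergy]
  exact ⟨harc.isUnitLoop.ofReal_le_tangentPointEnergy hinj hq0 hp1 hp2 hp3.le,
    harc.isUnitLoop.isCircle_of_tangentPointEnergy_eq hinj hq0 hp1 hp2 hp3,
    harc.isUnitLoop.tangentPointEnergy_eq_of_isCircle hinj hq0 hp1 hp2 hp3.le⟩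

end
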